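/- Let W be an ω-Stone space. Then the following are equivalent: (1) W is primitive; (2) W admits a rank P-partition for some PO system P; (3) the orbit diagram 𝒪(W) of W forms a rank partition of W. -/

import Mathlib

open Set Filter Topology

universe u v

/-- A PO system: a set with a transitive antisymmetric relation `<`. -/
structure POSystem (P : Type u) : Type u where
  lt : P → P → Prop
  lt_trans : ∀ {a b c}, lt a b → lt b c → lt a c
  lt_antisymm : ∀ {a b}, lt a b → lt b a → a = b

namespace POSystem

variable {P : Type*} {Q : Type*}

/-- `a ≤ b` iff `a < b` or `a = b`. -/
def le (S : POSystem P) (a b : P) : Prop := S.lt a b ∨ a = b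

theorem le_trans {S : POSystem P} {a b c : P} (h1 : S.le a b) (h2 : S.le b c) :
    S.le a c := by
  rcases h1 with h1 | rfl
  · rcases h2 with h2 | rfl
    · exact Or.inl (S.lt_trans h1 h2)
    · exact Or.inl h1
  · exact h2

/-- A morphism of PO systems. -/
def IsMorphism (SQ : POSystem Q) (SP : POSystem P) (α : Q → P) : Prop :=
  ∀ q : Q, α '' {r | SQ.lt q r} = {p | SP.lt (α q) p}

/-- An isomorphism of PO systems. -/
def IsIso (SQ : POSystem Q) (SP : POSystem P) (β : Q → P) : Prop :=
  Function.Bijective β ∧ ∀ a b : Q, SQ.lt a b ↔ SP.lt (β a) (β b)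

/-- An ideal of a PO system: a nonempty directed lower subset. -/
def IsIdeal (S : POSystem P) (J : Set P) : Prop :=
  J.Nonempty ∧ (∀ x ∈ J, ∀ y : P, S.le y x → y ∈ J) ∧
    ∀ x ∈ J, ∀ y ∈ J, ∃ z ∈ J, S.le x z ∧ S.le y z

/-- An ideal of a subset `Qs` of a PO system. -/
def IsIdealOf (S : POSystem P) (Qs : Set P) (J : Set P) : Prop :=
  J.Nonempty ∧ J ⊆ Qs ∧ (∀ x ∈ J, ∀ y ∈ Qs, S.le y x → y ∈ J) ∧
    ∀ x ∈ J, ∀ y ∈ J, ∃ z ∈ J, S.le x z ∧ S.le y z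

/-- The principal ideal `p↓`. -/
def principalIdeal (S : POSystem P) (p : P) : Set P := {q | S.le q p}

theorem principal_isIdeal (S : POSystem P) (p : P) : IsIdeal S (principalIdeal S p) :=
  ⟨⟨p, Or.inr rfl⟩, fun _ hx y hy => le_trans hy hx,
    fun _ hx _ hy => ⟨p, Or.inr rfl, hx, hy⟩⟩

/-- `p` is the supremum of the subset `A`. -/
def IsSupOf (S : POSystem P) (p : P) (A : Set P) : Prop :=
  (∀ a ∈ A, S.le a p) ∧ ∀ q : P, (∀ a ∈ A, S.le a q) → S.le p q

/-- `p` is separated in `P` if it is not the supremum of a strictly increasing sequence. -/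
def Separated (S : POSystem P) (p : P) : Prop :=
  ¬ ∃ u : ℕ → P, (∀ n, S.lt (u n) (u (n + 1)) ∧ u n ≠ u (n + 1)) ∧
      IsSupOf S p (Set.range u)

/-- `p` is compact in `P`. -/
def CompactIn (S : POSystem P) (p : P) : Prop :=
  ∀ J : Set P, IsIdeal S J → ∀ s : P, IsSupOf S s J → S.le p s → p ∈ J

/-- The lower closure `N↓` of a subset. -/
def downSet (S : POSystem P) (N : Set P) : Set P := {p | ∃ q ∈ N, S.le p q}

/-- `N` has a finite foundation. -/
def HasFinFoundation (S : POSystem P) (N : Set P) : Prop :=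
  ∃ F : Set P, F.Finite ∧ F ⊆ downSet S N ∧ ∀ r ∈ downSet S N, ∃ p ∈ F, S.le p r

def PDelta (S : POSystem P) : Set P := {p | HasFinFoundation S {p}}

def IsLowerSubset (S : POSystem P) (L : Set P) : Prop :=
  ∀ p ∈ L, ∀ q : P, S.le q p → q ∈ L

/-- Minimal elements of `L`. -/
def minIn (S : POSystem P) (L : Set P) : Set P :=
  {p | p ∈ L ∧ ∀ q ∈ L, S.le q p → q = p}

/-- `L_min^d`: minimal elements of `L` lying in `P^d`. -/
def LminD (S : POSystem P) (L : Set P) : Set P := {p | p ∈ minIn S L ∧ ¬ S.lt p p}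

/-- `(P, L, f)` is an extended PO system. -/
def IsExtPO (S : POSystem P) (L : Set P) (f : P → ℕ) : Prop :=
  IsLowerSubset S L ∧ L ⊆ PDelta S ∧ ∀ p ∈ LminD S L, 0 < f p

/-- The order relation on the ideal completion `id(P)`: ordered by inclusion, with
`id(P)^d` the principal ideals `p↓` for `p ∈ P^d`. -/
def idLt (S : POSystem P) (J K : {J : Set P // IsIdeal S J}) : Prop :=
  (J.1 ⊆ K.1 ∧ J ≠ K) ∨ (J = K ∧ ¬ ∃ p : P, ¬ S.lt p p ∧ J.1 = principalIdeal S p)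

/-- The ideal completion `id(P)` of a PO system. -/
def idPO (S : POSystem P) : POSystem {J : Set P // IsIdeal S J} where
  lt := idLt S
  lt_trans := by
    intro a b c h1 h2
    unfold idLt at h1 h2 ⊢
    rcases h1 with ⟨hab, hne⟩ | ⟨heq, h⟩
    · rcases h2 with ⟨hbc, hne'⟩ | ⟨heq', h'⟩
      · refine Or.inl ⟨hab.trans hbc, fun hac => hne ?_⟩
        exact Subtype.ext (subset_antisymm hab (by rw [hac]; exact hbc))
      · rw [← heq']; exact Or.inl ⟨hab, hne⟩
    · rw [heq]; exact h2
  lt_antisymm := by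
    intro a b h1 h2
    unfold idLt at h1 h2
    rcases h1 with ⟨hab, _⟩ | ⟨heq, _⟩
    · rcases h2 with ⟨hba, _⟩ | ⟨heq, _⟩
      · exact Subtype.ext (subset_antisymm hab hba)
      · exact heq.symm
    · exact heq

/-- The restriction of a PO system to a subset. -/
def restrictPO (S : POSystem P) (T : Set P) : POSystem T where
  lt a b := S.lt a b
  lt_trans := fun h1 h2 => S.lt_trans h1 h2
  lt_antisymm := fun h1 h2 => Subtype.ext (S.lt_antisymm h1 h2)

end POSystem

open POSystem

section Partitions

variable {W : Type*} [TopologicalSpace W] {P : Type*} {Q : Type*}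

/-- The derived set (set of limit points) of `A`. -/
def limitPts (A : Set W) : Set W := {x | x ∈ closure (A \ {x})}

/-- The type `T(A)` of a subset `A` with respect to a partition `X`. -/
def ptype (X : P → Set W) (A : Set W) : Set P := {p | (A ∩ X p).Nonempty}

/-- A `P`-partition of `W`: pairwise disjoint nonempty sets `X p` such that
`(X p)' ∩ X = ⋃_{q < p} X q`. -/
def IsPPartition (S : POSystem P) (X : P → Set W) : Prop :=
  (∀ p, (X p).Nonempty) ∧ (Pairwise fun p q => Disjoint (X p) (X q)) ∧
    ∀ p, limitPts (X p) ∩ (⋃ q, X q) = ⋃ q ∈ {q : P | S.lt q p}, X q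

/-- `A` is a `p`-trim set. -/
def IsTrimAt (S : POSystem P) (X : P → Set W) (A : Set W) (p : P) : Prop :=
  IsCompact A ∧ IsOpen A ∧ ptype X A = {q | S.le p q} ∧
    (¬ S.lt p p → ∃! x, x ∈ A ∩ X p)

/-- `A` is a trim set. -/
def IsTrimSet (S : POSystem P) (X : P → Set W) (A : Set W) : Prop :=
  ∃ p, IsTrimAt S X A p

/-- `P̂`: the set of `p` for which some `p`-trim set exists. -/
def Phat (S : POSystem P) (X : P → Set W) : Set P := {p | ∃ A, IsTrimAt S X A p}

/-- Axiom T1: every point has a neighbourhood base of trim sets. -/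
def HasTrimBases (S : POSystem P) (X : P → Set W) : Prop :=
  ∀ w : W, ∀ U ∈ nhds w, ∃ A, IsTrimSet S X A ∧ w ∈ A ∧ A ⊆ U

/-- Axiom T2 (fullness). -/
def IsFull (S : POSystem P) (X : P → Set W) : Prop :=
  ∀ p ∈ Phat S X, ∀ w : W,
    (∀ U ∈ nhds w, ∃ A, IsTrimAt S X A p ∧ w ∈ A ∧ A ⊆ U) → w ∈ X p

/-- `w` is a clean point. -/
def IsCleanPt (S : POSystem P) (X : P → Set W) (w : W) : Prop :=
  ∃ p, w ∈ X p ∧ ∃ A, IsTrimAt S X A p ∧ w ∈ A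

/-- Axiom T3: all points of `X` are clean. -/
def AllClean (S : POSystem P) (X : P → Set W) : Prop :=
  ∀ p : P, ∀ w ∈ X p, ∃ A, IsTrimAt S X A p ∧ w ∈ A

/-- A trim `P`-partition. -/
def IsTrimPartition (S : POSystem P) (X : P → Set W) : Prop :=
  IsPPartition S X ∧ HasTrimBases S X ∧ IsFull S X ∧ AllClean S X

/-- A complete partition: the blocks cover `W`. -/
def IsCompletePartition (X : P → Set W) : Prop := (⋃ p, X p) = Set.univ

/-- `Y` refines `Z` via `α`. -/
def Refines (Y : Q → Set W) (Z : P → Set W) (α : Q → P) : Prop :=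
  ∀ q, Y q ⊆ Z (α q)

/-- `Y` regularly refines `Z` via `α` (`Z` regularly consolidates `Y` via `α`). -/
def RegRefines (SQ : POSystem Q) (SP : POSystem P) (Y : Q → Set W) (Z : P → Set W)
    (α : Q → P) : Prop :=
  Refines Y Z α ∧ ∀ p ∈ Phat SP Z, ∀ A : Set W, IsTrimAt SP Z A p → p ∈ α '' ptype Y A

/-- A semi-trim partition: T1, T2, and clean points are dense in each `X p`, `p ∈ P̂`. -/
def IsSemiTrim (S : POSystem P) (X : P → Set W) : Prop :=
  IsPPartition S X ∧ HasTrimBases S X ∧ IsFull S X ∧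
    ∀ p ∈ Phat S X, X p ⊆ closure {w | w ∈ X p ∧ ∃ A, IsTrimAt S X A p ∧ w ∈ A}

/-- A strongly semi-trim partition: T1, T2, and all points of `X p` are clean, `p ∈ P̂`. -/
def IsStronglySemiTrim (S : POSystem P) (X : P → Set W) : Prop :=
  IsPPartition S X ∧ HasTrimBases S X ∧ IsFull S X ∧
    ∀ p ∈ Phat S X, ∀ w ∈ X p, ∃ A, IsTrimAt S X A p ∧ w ∈ A

/-- The labels of a sequence are pairwise strictly incomparable or strictly increasing. -/
def PairwiseIncompOrStrictIncr (S : POSystem P) (τ : ℕ → P) : Prop :=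
  (∀ j k, j ≠ k → ¬ S.le (τ j) (τ k)) ∨ (∀ j k, j < k → S.lt (τ j) (τ k) ∧ τ j ≠ τ k)

/-- A rank `P`-partition: a complete `P`-partition satisfying RP1 and RP2. -/
def IsRankPartition (S : POSystem P) (X : P → Set W) : Prop :=
  IsPPartition S X ∧ IsCompletePartition X ∧
    (∀ q : P, Separated S q → ∀ (x : W) (u : ℕ → W) (τx : P) (τu : ℕ → P),
      x ∈ X τx → (∀ k, u k ∈ X (τu k)) →
      Filter.Tendsto u Filter.atTop (nhds x) → (∀ k, u k ≠ x) →
      S.le q τx → PairwiseIncompOrStrictIncr S τu →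
      ∀ᶠ k in Filter.atTop, S.le q (τu k)) ∧
    (∀ (x : W) (τx : P), x ∈ X τx → ¬ Separated S τx →
      ∃ u : ℕ → W, Filter.Tendsto u Filter.atTop (nhds x) ∧
        ∀ k, ∃ q, u k ∈ X q ∧ S.lt q τx ∧ q ≠ τx)

/-- `I_w`: the set of types of trim neighbourhoods of `w`. -/
def Iw (S : POSystem P) (X : P → Set W) (w : W) : Set P :=
  {p | ∃ A : Set W, IsTrimAt S X A p ∧ w ∈ A}

/-- A trim `(P, L, f)`-partition. -/
def IsTrimPLF (S : POSystem P) (L : Set P) (f : P → ℕ) (Z : P → Set W) : Prop :=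
  IsTrimPartition S Z ∧ (∀ p, IsCompact (closure (Z p)) ↔ p ∈ L) ∧
    ∀ p ∈ LminD S L, Nat.card (Z p) = f p

/-- A bounded trim `(P, L, f)`-partition. -/
def IsBoundedTrimPLF (S : POSystem P) (L : Set P) (f : P → ℕ) (Z : P → Set W) : Prop :=
  IsTrimPLF S L f Z ∧ IsCompact (closure (⋃ p ∈ L, Z p))

end Partitions

section Primitive

variable {W : Type*} [TopologicalSpace W]

/-- The ideal `(A)` of compact open subsets of `A`. -/
def coIdeal (A : Set W) : Set (Set W) := {C | IsCompact C ∧ IsOpen C ∧ C ⊆ A}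

/-- `(A) ≅ (B)` as Boolean rings (equivalently, as posets). -/
def IdealIso (A B : Set W) : Prop := Nonempty (↥(coIdeal A) ≃o ↥(coIdeal B))

/-- `(A) × (B) ≅ (A)`. -/
def ProdIdealIso (A B : Set W) : Prop :=
  Nonempty ((↥(coIdeal A) × ↥(coIdeal B)) ≃o ↥(coIdeal A))

/-- A compact open `A` is pseudo-indecomposable (PI). -/
def IsPISet (A : Set W) : Prop :=
  IsCompact A ∧ IsOpen A ∧ ∀ B : Set W, IsCompact B → IsOpen B → B ⊆ A →
    IdealIso B A ∨ IdealIso (A \ B) A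

/-- `W` is primitive: every compact open set is a finite disjoint union of PI sets. -/
def PrimitiveSpace (W : Type*) [TopologicalSpace W] : Prop :=
  ∀ A : Set W, IsCompact A → IsOpen A →
    ∃ (n : ℕ) (F : Fin n → Set W), (∀ i, IsPISet (F i)) ∧
      (Pairwise fun i j => Disjoint (F i) (F j)) ∧ A = ⋃ i, F i

/-- The setoid of PI compact opens up to isomorphism of their ideals. -/
def piIsoSetoid (W : Type*) [TopologicalSpace W] : Setoid {A : Set W // IsPISet A} where
  r A B := IdealIso A.1 B.1
  iseqv := ⟨fun _ => ⟨OrderIso.refl _⟩,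
    fun h => h.elim fun e => ⟨e.symm⟩,
    fun h1 h2 => h1.elim fun e => h2.elim fun f => ⟨e.trans f⟩⟩

/-- The underlying set of the structure diagram `𝒮(W)`: isomorphism classes of
PI compact open subsets of `W`. -/
def SDiagram (W : Type*) [TopologicalSpace W] : Type _ := Quotient (piIsoSetoid W)

/-- The relation on `𝒮(W)`: `[A] < [B]` iff `(A) × (B) ≅ (A)`. -/
def SDiagramLt {W : Type*} [TopologicalSpace W] (x y : SDiagram W) : Prop :=
  ∃ A B : {A : Set W // IsPISet A}, x = Quotient.mk (piIsoSetoid W) A ∧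
    y = Quotient.mk (piIsoSetoid W) B ∧ ProdIdealIso A.1 B.1

/-- The blocks of the canonical partition `𝒳(W)`: points having a neighbourhood base
of compact open sets of class `p`. -/
def canonicalBlock {W : Type*} [TopologicalSpace W] (p : SDiagram W) : Set W :=
  {w | ∀ U ∈ nhds w, ∃ A : {A : Set W // IsPISet A},
      Quotient.mk (piIsoSetoid W) A = p ∧ w ∈ A.1 ∧ A.1 ⊆ U}

/-- The setoid of points of `W` under the homeomorphism group. -/
def homeoSetoid (W : Type*) [TopologicalSpace W] : Setoid W where
  r w x := ∃ h : W ≃ₜ W, h w = x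
  iseqv := ⟨fun w => ⟨Homeomorph.refl W, rfl⟩,
    fun h => h.elim fun e he => ⟨e.symm, by rw [← he, Homeomorph.symm_apply_apply]⟩,
    fun h1 h2 => h1.elim fun e he => h2.elim fun f hf =>
      ⟨e.trans f, by rw [Homeomorph.trans_apply, he, hf]⟩⟩

end Primitive

section Basics
variable {W : Type u} [TopologicalSpace W]

/-- compact open -/
def CO (A : Set W) : Prop := IsCompact A ∧ IsOpen A

theorem CO.empty : CO (∅ : Set W) := ⟨isCompact_empty, isOpen_empty⟩

theorem CO.union {A B : Set W} (hA : CO A) (hB : CO B) : CO (A ∪ B) :=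
  ⟨hA.1.union hB.1, hA.2.union hB.2⟩

theorem CO.inter [T2Space W] {A B : Set W} (hA : CO A) (hB : CO B) : CO (A ∩ B) :=
  ⟨hA.1.inter hB.1, hA.2.inter hB.2⟩

theorem CO.diff [T2Space W] {A B : Set W} (hA : CO A) (hB : CO B) : CO (A \ B) :=
  ⟨hA.1.diff hB.2, hA.2.sdiff hB.1.isClosed⟩

theorem CO.closed [T2Space W] {A : Set W} (hA : CO A) : IsClosed A := hA.1.isClosed

theorem exists_CO [LocallyCompactSpace W] [T2Space W] [TotallyDisconnectedSpace W]
    {x : W} {U : Set W} (hU : U ∈ 𝓝 x) : ∃ A, CO A ∧ x ∈ A ∧ A ⊆ U := by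
  obtain ⟨K, hK, hKU, hKc⟩ := local_compact_nhds hU
  obtain ⟨V, hV, hxV, hVK⟩ := (loc_compact_Haus_tot_disc_of_zero_dim (H := W)).exists_subset_of_mem_open
    (mem_interior_iff_mem_nhds.2 hK) isOpen_interior
  exact ⟨V, ⟨hKc.of_isClosed_subset hV.1 (hVK.trans interior_subset), hV.2⟩, hxV,
    (hVK.trans interior_subset).trans hKU⟩

theorem countable_CO [SecondCountableTopology W] : {A : Set W | CO A}.Countable := by
  have hb := TopologicalSpace.isBasis_countableBasis W
  have hc := TopologicalSpace.countable_countableBasis W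
  have : {s : Set (Set W) | s.Finite ∧ s ⊆ TopologicalSpace.countableBasis W}.Countable :=
    Set.Countable.mono (fun s hs => hs) (Set.countable_ofPred_finite_subset hc)
  refine (this.image (fun s => ⋃₀ s)).mono ?_
  rintro A ⟨hA, hAo⟩
  obtain ⟨s, hs, hs'⟩ := hb.open_eq_sUnion hAo
  obtain ⟨t, hts, htf, htA⟩ := hA.elim_finite_subcover_image (b := s) (c := id)
    (fun i hi => hb.isOpen (hs hi)) (by rw [hs', sUnion_eq_biUnion]; rfl)
  refine ⟨t, ⟨htf, hts.trans hs⟩, ?_⟩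
  apply subset_antisymm
  · dsimp only; rw [hs']; exact sUnion_subset_sUnion hts
  · dsimp only; rw [sUnion_eq_biUnion]; exact htA

theorem exists_enum [SecondCountableTopology W] : ∃ U : ℕ → Set W, (∀ n, CO (U n)) ∧
    ∀ A, CO A → ∃ n, U n = A := by
  obtain ⟨U, hU⟩ := (countable_CO (W := W)).exists_eq_range ⟨∅, CO.empty⟩
  exact ⟨U, fun n => (hU ▸ mem_range_self n : U n ∈ {A | CO A}), fun A hA => by
    have : A ∈ range U := hU ▸ hA
    exact this⟩

theorem exists_CO_between [LocallyCompactSpace W] [T2Space W] [TotallyDisconnectedSpace W]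
    {K O : Set W} (hK : IsCompact K) (hO : IsOpen O) (h : K ⊆ O) : ∃ A, CO A ∧ K ⊆ A ∧ A ⊆ O := by
  have := hK.induction_on (p := fun K => ∃ A, CO A ∧ K ⊆ A ∧ A ⊆ O)
    ⟨∅, CO.empty, subset_rfl, empty_subset _⟩
    (fun s t hst ⟨A, h1, h2, h3⟩ => ⟨A, h1, hst.trans h2, h3⟩)
    (fun s t ⟨A, h1, h2, h3⟩ ⟨B, h1', h2', h3'⟩ =>
      ⟨A ∪ B, h1.union h1', union_subset_union h2 h2', union_subset h3 h3'⟩)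
    (fun x hx => by
      obtain ⟨A, hA, hxA, hAO⟩ := exists_CO (hO.mem_nhds (h hx))
      exact ⟨A, mem_nhdsWithin_of_mem_nhds (hA.2.mem_nhds hxA), A, hA, subset_rfl, hAO⟩)
  exact this

/-- homeomorphic open subsets -/
def Iso (A B : Set W) : Prop := ∃ e : OpenPartialHomeomorph W W, e.source = A ∧ e.target = B

theorem Iso.refl {A : Set W} (hA : IsOpen A) : Iso A A :=
  ⟨OpenPartialHomeomorph.ofSet A hA, rfl, rfl⟩

theorem Iso.symm {A B : Set W} (h : Iso A B) : Iso B A := by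
  obtain ⟨e, rfl, rfl⟩ := h
  exact ⟨e.symm, rfl, rfl⟩

theorem Iso.trans {A B C : Set W} (h : Iso A B) (h' : Iso B C) : Iso A C := by
  obtain ⟨e, rfl, rfl⟩ := h
  obtain ⟨f, h, rfl⟩ := h'
  exact ⟨e.trans' f h.symm, rfl, rfl⟩

theorem Iso.union {A B C D : Set W} (h : Iso A B) (h' : Iso C D) (hd : Disjoint A C)
    (hd' : Disjoint B D) : Iso (A ∪ C) (B ∪ D) := by
  classical
  obtain ⟨e, rfl, rfl⟩ := h
  obtain ⟨f, rfl, rfl⟩ := h'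
  exact ⟨e.disjointUnion f hd hd', rfl, rfl⟩

theorem Iso.CO {A B : Set W} (h : Iso A B) (hA : CO A) : CO B := by
  obtain ⟨e, rfl, rfl⟩ := h
  refine ⟨?_, e.open_target⟩
  have := hA.1.image_of_continuousOn e.continuousOn
  rwa [e.image_source_eq_target] at this

theorem oph_sub (e : OpenPartialHomeomorph W W) {C : Set W} (hC : IsOpen C) (h : C ⊆ e.source) :
    ∃ f : OpenPartialHomeomorph W W, f.source = C ∧ f.target = e '' C ∧ ∀ x, f x = e x := by
  refine ⟨e.restrOpen C hC, ?_, ?_, fun x => rfl⟩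
  · rw [e.restrOpen_source, inter_eq_right.2 h]
  · rw [← (e.restrOpen C hC).image_source_eq_target, e.restrOpen_source, inter_eq_right.2 h]
    rfl

/-- splitting along an Iso -/
theorem Iso.split {A B : Set W} (h : Iso A B) {C : Set W} (hC : IsOpen C) (hC' : IsOpen (A \ C))
    (hCA : C ⊆ A) :
    ∃ D ⊆ B, Iso C D ∧ Iso (A \ C) (B \ D) := by
  obtain ⟨e, rfl, rfl⟩ := h
  obtain ⟨f, hf, hf', -⟩ := oph_sub e hC hCA
  obtain ⟨g, hg, hg', -⟩ := oph_sub e hC' sdiff_subset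
  refine ⟨e '' C, ?_, ⟨f, hf, hf'⟩, ⟨g, hg, ?_⟩⟩
  · rw [← e.image_source_eq_target]; exact image_mono hCA
  · rw [hg', e.injOn.image_sdiff_subset hCA, e.image_source_eq_target]

theorem Iso.empty {B : Set W} (h : Iso (∅ : Set W) B) : B = ∅ := by
  obtain ⟨e, h, rfl⟩ := h
  rw [← e.image_source_eq_target, h, image_empty]

theorem Iso.nonempty {A B : Set W} (h : Iso A B) (hA : A.Nonempty) : B.Nonempty := by
  rw [nonempty_iff_ne_empty] at *
  rintro rfl
  exact hA h.symm.empty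

theorem Iso.idealIso {A B : Set W} (h : Iso A B) : IdealIso A B := by
  obtain ⟨e, rfl, rfl⟩ := h
  have key : ∀ (e : OpenPartialHomeomorph W W) (C : Set W), C ∈ coIdeal e.source →
      e '' C ∈ coIdeal e.target := by
    rintro e C ⟨h1, h2, h3⟩
    refine ⟨h1.image_of_continuousOn (e.continuousOn.mono h3), e.isOpen_image_of_subset_source h2 h3,
      ?_⟩
    rw [← e.image_source_eq_target]; exact image_mono h3
  refine ⟨⟨⟨fun C => ⟨e '' C.1, key e C.1 C.2⟩, fun D => ⟨e.symm '' D.1, key e.symm D.1 D.2⟩, ?_, ?_⟩,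
    ?_⟩⟩
  · rintro ⟨C, h1, h2, h3⟩
    exact Subtype.ext ((e.leftInvOn.mono h3).image_image)
  · rintro ⟨C, h1, h2, h3⟩
    exact Subtype.ext ((e.rightInvOn.mono h3).image_image)
  · rintro ⟨C, h1, h2, h3⟩ ⟨D, h1', h2', h3'⟩
    exact (e.injOn.image_subset_image_iff h3 h3')

end Basics

section Vaught
variable {W : Type u} [TopologicalSpace W]

structure IsTree (c : List Bool → Set W) : Prop where
  co : ∀ s, CO (c s)
  un : ∀ s, c s = c (true :: s) ∪ c (false :: s)
  dj : ∀ s, Disjoint (c (true :: s)) (c (false :: s))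
  base : ∀ x ∈ c [], ∀ V ∈ 𝓝 x, ∃ s, x ∈ c s ∧ c s ⊆ V

namespace IsTree
variable {c d : List Bool → Set W}

theorem sub (hc : IsTree c) (b : Bool) (s : List Bool) : c (b :: s) ⊆ c s := by
  rw [hc.un s]
  cases b
  · exact subset_union_right
  · exact subset_union_left

theorem sub_nil (hc : IsTree c) (s : List Bool) : c s ⊆ c [] := by
  induction s with
  | nil => exact subset_rfl
  | cons b s ih => exact (hc.sub b s).trans ih

theorem uniq (hc : IsTree c) {a : W} : ∀ {s t : List Bool}, s.length = t.length →
    a ∈ c s → a ∈ c t → s = t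
  | [], [], _, _, _ => rfl
  | b :: s, b' :: t, h, hs, ht => by
    have : s = t := uniq hc (by simpa using h) (hc.sub _ _ hs) (hc.sub _ _ ht)
    subst this
    have := Set.disjoint_left.1 (hc.dj s)
    cases b <;> cases b' <;> first | rfl | (exfalso; tauto)
  | [], _ :: _, h, _, _ => by simp at h
  | _ :: _, [], h, _, _ => by simp at h

theorem exists_pt [T2Space W] (hc : IsTree c) (hd : IsTree d)
    (hcd : ∀ s, (c s).Nonempty → (d s).Nonempty)
    {a : W} (ha : a ∈ c []) : ∃ b, ∀ s, a ∈ c s ↔ b ∈ d s := by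
  classical
  let σ : ℕ → List Bool := fun n => Nat.rec [] (fun _ s => (decide (a ∈ c (true :: s))) :: s) n
  have hσ : ∀ n, σ (n+1) = (decide (a ∈ c (true :: σ n))) :: σ n := fun n => rfl
  have hl : ∀ n, (σ n).length = n := by
    intro n
    induction n with
    | zero => rfl
    | succ n ih => rw [hσ, List.length_cons, ih]
  have hm : ∀ n, a ∈ c (σ n) := by
    intro n
    induction n with
    | zero => exact ha
    | succ n ih =>
      rw [hσ]
      by_cases h : a ∈ c (true :: σ n)
      · simp [h]
      · have := ih
        rw [hc.un] at this
        simpa [h] using this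
  obtain ⟨b, hb⟩ := IsCompact.nonempty_iInter_of_sequence_nonempty_isCompact_isClosed
    (fun n => d (σ n)) (fun n => by rw [hσ]; exact hd.sub _ _)
    (fun n => hcd _ ⟨a, hm n⟩) (hd.co _).1 (fun n => (hd.co _).closed)
  rw [mem_iInter] at hb
  refine ⟨b, fun s => ⟨fun h => ?_, fun h => ?_⟩⟩
  · rw [hc.uniq (hl s.length).symm h (hm _)]; exact hb _
  · rw [hd.uniq (hl s.length).symm h (hb _)]; exact hm _

theorem pt_uniq [T2Space W] (hd : IsTree d) {a b b' : W} (ha : a ∈ c [])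
    (hb : ∀ s, a ∈ c s ↔ b ∈ d s) (hb' : ∀ s, a ∈ c s ↔ b' ∈ d s) : b = b' := by
  by_contra hne
  obtain ⟨s, hs, hs'⟩ := hd.base b ((hb []).1 ha) {b'}ᶜ (isOpen_compl_singleton.mem_nhds hne)
  exact hs' ((hb' s).1 ((hb s).2 hs)) rfl

theorem oph [T2Space W] (hc : IsTree c) (hd : IsTree d)
    (hcd : ∀ s, (c s).Nonempty ↔ (d s).Nonempty) :
    ∃ e : OpenPartialHomeomorph W W, e.source = c [] ∧ e.target = d [] ∧
      ∀ a ∈ c [], ∀ s, a ∈ c s ↔ e a ∈ d s := by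
  classical
  have h1 : ∀ a, ∃ b, a ∈ c [] → ∀ s, a ∈ c s ↔ b ∈ d s := fun a => by
    by_cases ha : a ∈ c []
    · obtain ⟨b, hb⟩ := exists_pt hc hd (fun s => (hcd s).1) ha
      exact ⟨b, fun _ => hb⟩
    · exact ⟨a, fun h => absurd h ha⟩
  have h2 : ∀ a, ∃ b, a ∈ d [] → ∀ s, a ∈ d s ↔ b ∈ c s := fun a => by
    by_cases ha : a ∈ d []
    · obtain ⟨b, hb⟩ := exists_pt hd hc (fun s => (hcd s).2) ha
      exact ⟨b, fun _ => hb⟩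
    · exact ⟨a, fun h => absurd h ha⟩
  choose f hf using h1
  choose g hg using h2
  have mf : ∀ a ∈ c [], f a ∈ d [] := fun a ha => (hf a ha []).1 ha
  have mg : ∀ a ∈ d [], g a ∈ c [] := fun a ha => (hg a ha []).1 ha
  have cont : ∀ {c d : List Bool → Set W} {f : W → W}, IsTree c → IsTree d →
      (∀ a ∈ c [], ∀ s, a ∈ c s ↔ f a ∈ d s) → ContinuousOn f (c []) := by
    intro c d f hc hd hf a ha V hV
    obtain ⟨s, hs, hsV⟩ := hd.base (f a) ((hf a ha []).1 ha) V hV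
    refine mem_nhdsWithin_of_mem_nhds (mem_of_superset ((hc.co s).2.mem_nhds ((hf a ha s).2 hs)) ?_)
    intro x hx
    exact hsV ((hf x (hc.sub_nil s hx) s).1 hx)
  exact ⟨{  toFun := f
            invFun := g
            source := c []
            target := d []
            map_source' := mf
            map_target' := mg
            left_inv' := fun a ha => pt_uniq hc (mf a ha) (hg _ (mf a ha)) (fun s => (hf a ha s).symm)
            right_inv' := fun a ha => pt_uniq hd (mg a ha) (hf _ (mg a ha)) (fun s => (hg a ha s).symm)
            open_source := (hc.co []).2
            open_target := (hd.co []).2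
            continuousOn_toFun := cont hc hd hf
            continuousOn_invFun := cont hd hc hg }, rfl, rfl, hf⟩

end IsTree

/-- Vaught's back and forth -/
theorem vaught [SecondCountableTopology W] [LocallyCompactSpace W] [T2Space W]
    [TotallyDisconnectedSpace W] (R : Set W → Set W → Prop)
    (hco : ∀ A B, R A B → CO A ∧ CO B)
    (hne : ∀ A B, R A B → (A.Nonempty ↔ B.Nonempty))
    (hl : ∀ A B, R A B → ∀ U, CO U → ∃ D, R (A ∩ U) (B ∩ D) ∧ R (A \ U) (B \ D))
    (hr : ∀ A B, R A B → ∀ U, CO U → ∃ D, R (A ∩ D) (B ∩ U) ∧ R (A \ D) (B \ U))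
    {A B : Set W} (hAB : R A B) : ∃ e : OpenPartialHomeomorph W W, e.source = A ∧ e.target = B ∧
      ∀ a ∈ A, ∀ V ∈ 𝓝 (e a), ∃ C D, R C D ∧ a ∈ C ∧ e a ∈ D ∧ D ⊆ V := by
  obtain ⟨U, hU, hU'⟩ := exists_enum (W := W)
  have step : ∀ (p : {p : Set W × Set W // R p.1 p.2}) (n : ℕ), ∃ C D : Set W,
      ((n % 2 = 0 → C = U (n / 2)) ∧ (n % 2 = 1 → D = U (n / 2))) ∧
      R (p.1.1 ∩ C) (p.1.2 ∩ D) ∧ R (p.1.1 \ C) (p.1.2 \ D) := by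
    rintro ⟨⟨A, B⟩, h⟩ n
    rcases Nat.mod_two_eq_zero_or_one n with hn | hn
    · obtain ⟨D, hD⟩ := hl A B h (U (n/2)) (hU _)
      exact ⟨U (n/2), D, ⟨fun _ => rfl, by omega⟩, hD⟩
    · obtain ⟨D, hD⟩ := hr A B h (U (n/2)) (hU _)
      exact ⟨D, U (n/2), ⟨by omega, fun _ => rfl⟩, hD⟩
  choose C D hCD hR1 hR2 using step
  let T : List Bool → {p : Set W × Set W // R p.1 p.2} := fun s =>
    List.rec ⟨(A, B), hAB⟩ (fun b s p =>
      bif b then ⟨(p.1.1 ∩ C p s.length, p.1.2 ∩ D p s.length), hR1 p s.length⟩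
      else ⟨(p.1.1 \ C p s.length, p.1.2 \ D p s.length), hR2 p s.length⟩) s
  have T1 : ∀ s, T (true :: s) = ⟨((T s).1.1 ∩ C (T s) s.length, (T s).1.2 ∩ D (T s) s.length), hR1 _ _⟩ :=
    fun s => rfl
  have T2 : ∀ s, T (false :: s) = ⟨((T s).1.1 \ C (T s) s.length, (T s).1.2 \ D (T s) s.length), hR2 _ _⟩ :=
    fun s => rfl
  have lev : ∀ (c : List Bool → Set W), (∀ s, c s = c (true :: s) ∪ c (false :: s)) →
      ∀ x ∈ c [], ∀ n, ∃ s : List Bool, s.length = n ∧ x ∈ c s := by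
    intro c hc x hx n
    induction n with
    | zero => exact ⟨[], rfl, hx⟩
    | succ n ih =>
      obtain ⟨s, hs, hx⟩ := ih
      rw [hc] at hx
      rcases hx with hx | hx
      · exact ⟨_, by simp [hs], hx⟩
      · exact ⟨_, by simp [hs], hx⟩
  have u1 : ∀ s, (T s).1.1 = (T (true :: s)).1.1 ∪ (T (false :: s)).1.1 := by
    intro s; rw [T1, T2]; exact (inter_union_sdiff _ _).symm
  have u2 : ∀ s, (T s).1.2 = (T (true :: s)).1.2 ∪ (T (false :: s)).1.2 := by
    intro s; rw [T1, T2]; exact (inter_union_sdiff _ _).symm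
  have t1 : IsTree (fun s => (T s).1.1) := by
    refine ⟨fun s => (hco _ _ (T s).2).1, u1, fun s => ?_, ?_⟩
    · rw [T1, T2]; exact disjoint_sdiff_inter.symm
    · intro x hx V hV
      obtain ⟨G, hG, hxG, hGV⟩ := exists_CO hV
      obtain ⟨n, rfl⟩ := hU' G hG
      obtain ⟨s, hs, hxs⟩ := lev _ u1 x hx (2 * n)
      have hC : C (T s) s.length = U n := by
        have := (hCD (T s) s.length).1 (by omega)
        rw [this, hs]; congr 1; omega
      refine ⟨true :: s, ?_, ?_⟩
      · rw [T1]; dsimp only; rw [hC]; exact ⟨hxs, hxG⟩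
      · rw [T1]; dsimp only; rw [hC]; exact inter_subset_right.trans hGV
  have t2 : IsTree (fun s => (T s).1.2) := by
    refine ⟨fun s => (hco _ _ (T s).2).2, u2, fun s => ?_, ?_⟩
    · rw [T1, T2]; exact disjoint_sdiff_inter.symm
    · intro x hx V hV
      obtain ⟨G, hG, hxG, hGV⟩ := exists_CO hV
      obtain ⟨n, rfl⟩ := hU' G hG
      obtain ⟨s, hs, hxs⟩ := lev _ u2 x hx (2 * n + 1)
      have hC : D (T s) s.length = U n := by
        have := (hCD (T s) s.length).2 (by omega)
        rw [this, hs]; congr 1; omega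
      refine ⟨true :: s, ?_, ?_⟩
      · rw [T1]; dsimp only; rw [hC]; exact ⟨hxs, hxG⟩
      · rw [T1]; dsimp only; rw [hC]; exact inter_subset_right.trans hGV
  obtain ⟨e, he1, he2, he3⟩ := IsTree.oph t1 t2 (fun s => hne _ _ (T s).2)
  refine ⟨e, he1, he2, fun a ha V hV => ?_⟩
  obtain ⟨s, hs, hsV⟩ := t2.base (e a) ((he3 a ha []).1 ha) V hV
  exact ⟨_, _, (T s).2, (he3 a ha s).2 hs, hs, hsV⟩

/-- Stone duality for compact opens -/
theorem IdealIso.iso [SecondCountableTopology W] [LocallyCompactSpace W] [T2Space W]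
    [TotallyDisconnectedSpace W] {A B : Set W} (hA : CO A) (hB : CO B) (h : IdealIso A B) :
    Iso A B := by
  let R : Set W → Set W → Prop := fun A B => CO A ∧ CO B ∧ IdealIso A B
  have symm : ∀ A B, R A B → R B A := fun A B ⟨h1, h2, ⟨e⟩⟩ => ⟨h2, h1, ⟨e.symm⟩⟩
  have top : ∀ (A B : Set W) (hA : CO A) (hB : CO B) (e : ↥(coIdeal A) ≃o ↥(coIdeal B)) ,
      e ⟨A, hA.1, hA.2, subset_rfl⟩ = ⟨B, hB.1, hB.2, subset_rfl⟩ := by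
    intro A B hA hB e
    apply le_antisymm
    · exact (e _).2.2.2
    · rw [← e.symm_apply_le]; exact (e.symm _).2.2.2
  have ne' : ∀ A B, R A B → A.Nonempty → B.Nonempty := by
    rintro A B ⟨hA, hB, ⟨e⟩⟩ hne
    rw [nonempty_iff_ne_empty] at *
    rintro rfl
    apply hne
    have h1 := top A ∅ hA hB e
    have : e ⟨∅, isCompact_empty, isOpen_empty, empty_subset _⟩ =
        ⟨∅, isCompact_empty, isOpen_empty, empty_subset _⟩ := by
      apply Subtype.ext
      exact subset_empty_iff.1 (e _).2.2.2
    have h2 := e.injective (h1.trans this.symm)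
    exact congrArg Subtype.val h2
  have restr : ∀ (A B : Set W) (e : ↥(coIdeal A) ≃o ↥(coIdeal B)) (C : ↥(coIdeal A)), IdealIso C.1 (e C).1 := by
    intro A B e C
    refine ⟨⟨⟨fun E => ⟨(e ⟨E.1, E.2.1, E.2.2.1, E.2.2.2.trans C.2.2.2⟩).1, ?_⟩,
      fun E => ⟨(e.symm ⟨E.1, E.2.1, E.2.2.1, E.2.2.2.trans (e C).2.2.2⟩).1, ?_⟩, ?_, ?_⟩, ?_⟩⟩
    · refine ⟨(e _).2.1, (e _).2.2.1, ?_⟩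
      exact e.monotone (show (⟨E.1, E.2.1, E.2.2.1, E.2.2.2.trans C.2.2.2⟩ : ↥(coIdeal A)) ≤ C from E.2.2.2)
    · refine ⟨(e.symm _).2.1, (e.symm _).2.2.1, ?_⟩
      have : e.symm ⟨E.1, E.2.1, E.2.2.1, E.2.2.2.trans (e C).2.2.2⟩ ≤ C := by
        rw [e.symm_apply_le]; exact E.2.2.2
      exact this
    · intro E
      have h1 := e.symm_apply_apply (⟨E.1, E.2.1, E.2.2.1, E.2.2.2.trans C.2.2.2⟩ : ↥(coIdeal A))
      have h2 := congrArg (fun z : ↥(coIdeal A) => z.1) h1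
      exact Subtype.ext h2
    · intro E
      have h1 := e.apply_symm_apply (⟨E.1, E.2.1, E.2.2.1, E.2.2.2.trans (e C).2.2.2⟩ : ↥(coIdeal B))
      have h2 := congrArg (fun z : ↥(coIdeal B) => z.1) h1
      exact Subtype.ext h2
    · intro E F
      exact e.le_iff_le
  have compl : ∀ (A B : Set W) (hA : CO A) (hB : CO B) (e : ↥(coIdeal A) ≃o ↥(coIdeal B)) (C : ↥(coIdeal A))
      (C' : ↥(coIdeal A)), C'.1 = A \ C.1 → (e C').1 = B \ (e C).1 := by
    intro A B hA hB e C C' hC'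
    apply subset_antisymm
    · rw [subset_sdiff]
      refine ⟨(e C').2.2.2, ?_⟩
      have hco : CO ((e C').1 ∩ (e C).1) := CO.inter ⟨(e C').2.1, (e C').2.2.1⟩ ⟨(e C).2.1, (e C).2.2.1⟩
      let Z : ↥(coIdeal B) := ⟨(e C').1 ∩ (e C).1, hco.1, hco.2, inter_subset_left.trans (e C').2.2.2⟩
      have z1 : e.symm Z ≤ C' := by rw [e.symm_apply_le]; exact inter_subset_left
      have z2 : e.symm Z ≤ C := by rw [e.symm_apply_le]; exact inter_subset_right
      have z3 : (e.symm Z).1 = ∅ := by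
        apply subset_empty_iff.1
        intro x hx
        have h1 : x ∈ C'.1 := z1 hx
        rw [hC'] at h1
        exact h1.2 (z2 hx)
      have hzz : (∅ : Set W) ∈ coIdeal A := ⟨isCompact_empty, isOpen_empty, empty_subset _⟩
      have z4 : e.symm Z ≤ e.symm ⟨∅, isCompact_empty, isOpen_empty, empty_subset _⟩ := by
        show (e.symm Z).1 ⊆ _
        rw [z3]; exact empty_subset _
      have z5 := e.symm.le_iff_le.1 z4
      rw [disjoint_iff_inter_eq_empty]
      exact subset_empty_iff.1 z5
    · have hco : CO ((e C').1 ∪ (e C).1) := CO.union ⟨(e C').2.1, (e C').2.2.1⟩ ⟨(e C).2.1, (e C).2.2.1⟩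
      let Z : ↥(coIdeal B) := ⟨(e C').1 ∪ (e C).1, hco.1, hco.2, union_subset (e C').2.2.2 (e C).2.2.2⟩
      have z1 : C' ≤ e.symm Z := by rw [e.le_symm_apply]; exact subset_union_left
      have z2 : C ≤ e.symm Z := by rw [e.le_symm_apply]; exact subset_union_right
      have z3 : (⟨A, hA.1, hA.2, subset_rfl⟩ : ↥(coIdeal A)) ≤ e.symm Z := by
        intro x hx
        by_cases hxC : x ∈ C.1
        · exact z2 hxC
        · exact z1 (show x ∈ C'.1 by rw [hC']; exact ⟨hx, hxC⟩)
      rw [e.le_symm_apply, top A B hA hB] at z3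
      intro x hx
      have : x ∈ Z.1 := z3 hx.1
      exact this.resolve_right hx.2
  have split : ∀ A B, R A B → ∀ U, CO U → ∃ D, R (A ∩ U) (B ∩ D) ∧ R (A \ U) (B \ D) := by
    rintro A B ⟨hA, hB, ⟨e⟩⟩ U hU
    have h1 := hA.inter hU
    have h2 := hA.diff hU
    let C : ↥(coIdeal A) := ⟨A ∩ U, h1.1, h1.2, inter_subset_left⟩
    let C' : ↥(coIdeal A) := ⟨A \ U, h2.1, h2.2, sdiff_subset⟩
    refine ⟨(e C).1, ⟨h1, ?_, ?_⟩, h2, ?_, ?_⟩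
    · rw [inter_eq_right.2 (e C).2.2.2]; exact ⟨(e C).2.1, (e C).2.2.1⟩
    · rw [inter_eq_right.2 (e C).2.2.2]; exact restr A B e C
    · exact hB.diff ⟨(e C).2.1, (e C).2.2.1⟩
    · rw [← compl A B hA hB e C C' (by simp [C, C'])]
      exact restr A B e C'
  obtain ⟨e, h1, h2, -⟩ := vaught R (fun A B h => ⟨h.1, h.2.1⟩)
    (fun A B h => ⟨ne' A B h, ne' B A (symm _ _ h)⟩) split
    (fun A B h U hU => by
      obtain ⟨D, h1, h2⟩ := split B A (symm _ _ h) U hU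
      exact ⟨D, symm _ _ h1, symm _ _ h2⟩) ⟨hA, hB, h⟩
  exact ⟨e, h1, h2⟩

end Vaught

section RankToPrim
variable {W : Type u} [TopologicalSpace W]

theorem exists_clopen_refine [LocallyCompactSpace W] [T2Space W] [TotallyDisconnectedSpace W]
    (Z : Finset W) (O : W → Set W) (hO : ∀ z, IsOpen (O z)) :
    ∀ U : Set W, CO U → (∀ y ∈ U, ∃ z ∈ Z, y ∈ O z) → ∃ V : W → Set W, (∀ z, CO (V z)) ∧
      (∀ z ∈ Z, V z ⊆ O z) ∧ (∀ z ∈ Z, ∀ z' ∈ Z, z ≠ z' → Disjoint (V z) (V z')) ∧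
      U = ⋃ z ∈ Z, V z := by
  classical
  induction Z using Finset.induction_on with
  | empty =>
    intro U hU h
    refine ⟨fun _ => ∅, fun _ => CO.empty, by simp, by simp, ?_⟩
    simp only [Finset.notMem_empty, iUnion_of_empty, iUnion_empty]
    exact eq_empty_of_forall_notMem (fun y hy => by simpa using h y hy)
  | insert a Z ha ih =>
    intro U hU h
    have hF : IsOpen (⋃ z ∈ Z, O z) := isOpen_biUnion (fun z _ => hO z)
    obtain ⟨N, hN, hKN, hNO⟩ := exists_CO_between (hU.1.diff hF) ((hO a).inter hU.2) (by
      rintro y ⟨hy, hy'⟩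
      obtain ⟨z, hz, hyz⟩ := h y hy
      rcases Finset.mem_insert.1 hz with rfl | hz
      · exact ⟨hyz, hy⟩
      · exact absurd (mem_biUnion hz hyz) hy')
    obtain ⟨V, h1, h2, h3, h4⟩ := ih (U \ N) (hU.diff hN) (by
      rintro y ⟨hy, hyN⟩
      by_contra hcon
      push Not at hcon
      exact hyN (hKN ⟨hy, by simpa using hcon⟩))
    have hVN : ∀ z ∈ Z, Disjoint N (V z) := by
      intro z hz
      have : V z ⊆ U \ N := by rw [h4]; exact subset_biUnion_of_mem (u := V) hz
      exact Set.disjoint_left.2 fun y hy hy' => (this hy').2 hy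
    have hne : ∀ z ∈ Z, z ≠ a := fun z hz h => ha (h ▸ hz)
    refine ⟨Function.update V a N, ?_, ?_, ?_, ?_⟩
    · intro z
      by_cases hz : z = a
      · subst hz; simpa using hN
      · simpa [hz] using h1 z
    · intro z hz
      rcases Finset.mem_insert.1 hz with rfl | hz
      · simpa using hNO.trans inter_subset_left
      · simpa [hne z hz] using h2 z hz
    · intro z hz z' hz' hzz
      rcases Finset.mem_insert.1 hz with rfl | hz2 <;> rcases Finset.mem_insert.1 hz' with rfl | hz3
      · exact absurd rfl hzz
      · simpa [hne z' hz3] using hVN z' hz3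
      · simpa [hne z hz2] using (hVN z hz2).symm
      · simpa [hne z' hz3, hne z hz2] using h3 z hz2 z' hz3 hzz
    · have : (⋃ z ∈ Z, Function.update V a N z) = ⋃ z ∈ Z, V z := by
        refine iUnion₂_congr fun z hz => ?_
        simp [hne z hz]
      rw [Finset.set_biUnion_insert, this, ← h4]
      simp only [Function.update_self]
      rw [union_sdiff_cancel (hNO.trans inter_subset_right)]

variable {P : Type v}

/-- rank partition data in label form -/
structure RankData (S : POSystem P) (τ : W → P) : Prop where
  lim : ∀ x p, x ∈ limitPts {y | τ y = p} ↔ S.lt (τ x) p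
  rp1 : ∀ q : P, Separated S q → ∀ (x : W) (u : ℕ → W),
      Filter.Tendsto u Filter.atTop (nhds x) → (∀ k, u k ≠ x) →
      S.le q (τ x) → PairwiseIncompOrStrictIncr S (fun k => τ (u k)) →
      ∀ᶠ k in Filter.atTop, S.le q (τ (u k))
  rp2 : ∀ x, ¬ Separated S (τ x) →
      ∃ u : ℕ → W, Filter.Tendsto u Filter.atTop (nhds x) ∧
        ∀ k, S.lt (τ (u k)) (τ x) ∧ τ (u k) ≠ τ x

theorem rankData_of (S : POSystem P) (X : P → Set W) (h : IsRankPartition S X) :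
    ∃ τ : W → P, RankData S τ := by
  obtain ⟨⟨hne, hdj, hlim⟩, hcomp, h1, h2⟩ := h
  have : ∀ x, ∃ p, x ∈ X p := fun x => by
    have : x ∈ ⋃ p, X p := by rw [hcomp]; trivial
    simpa using this
  choose τ hτ using this
  have hX : ∀ x p, x ∈ X p ↔ τ x = p := by
    intro x p
    refine ⟨fun h => ?_, fun h => h ▸ hτ x⟩
    by_contra hne
    exact Set.disjoint_left.1 (hdj hne) (hτ x) h
  have hXe : ∀ p, X p = {y | τ y = p} := fun p => Set.ext fun x => hX x p
  refine ⟨τ, ⟨?_, ?_, ?_⟩⟩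
  · intro x p
    have := hlim p
    rw [show (⋃ q, X q) = univ from hcomp, inter_univ, hXe] at this
    rw [this]
    simp [hX]
  · intro q hq x u hu hux hqx hp
    exact h1 q hq x u (τ x) (fun k => τ (u k)) (hτ x) (fun k => hτ _) hu hux hqx hp
  · intro x hx
    obtain ⟨u, hu, hu'⟩ := h2 x (τ x) (hτ x) hx
    refine ⟨u, hu, fun k => ?_⟩
    obtain ⟨q, hq, hq'⟩ := hu' k
    rw [hX] at hq
    rwa [hq]

variable {S : POSystem P} {τ : W → P}

theorem po_le_antisymm {a b : P} (h1 : S.le a b) (h2 : S.le b a) : a = b := by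
  rcases h1 with h1 | h1
  · rcases h2 with h2 | h2
    · exact S.lt_antisymm h1 h2
    · exact h2.symm
  · exact h1

namespace RankData

theorem cl (h : RankData S τ) {x : W} {p : P} (hx : x ∈ closure {y | τ y = p}) : S.le (τ x) p := by
  by_cases hxp : τ x = p
  · exact Or.inr hxp
  · left
    rw [← h.lim]
    show x ∈ closure _
    rwa [sdiff_singleton_eq_self]
    exact hxp

theorem cl' (h : RankData S τ) {x : W} {p : P} : x ∈ closure {y | τ y = p} ↔ S.le (τ x) p := by
  refine ⟨h.cl, ?_⟩
  rintro (hx | hx)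
  · rw [← h.lim] at hx
    exact closure_mono sdiff_subset hx
  · exact subset_closure hx

theorem closed (h : RankData S τ) (p : P) : IsClosed {x | S.le (τ x) p} := by
  have : {x | S.le (τ x) p} = closure {y | τ y = p} := Set.ext fun x => h.cl'.symm
  rw [this]; exact isClosed_closure

theorem rp1' [FirstCountableTopology W] (h : RankData S τ) {q : P} (hq : Separated S q) :
    IsOpen {x | S.le q (τ x)} := by
  rw [isOpen_iff_mem_nhds]
  intro x hx
  by_contra hcon
  have hf : ∃ᶠ y in 𝓝 x, ¬ S.le q (τ y) := by
    rw [← Filter.not_eventually]; exact hcon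
  obtain ⟨u, hu, hu'⟩ := exists_seq_forall_of_frequently hf
  have tr : IsTrans W (fun a b => S.le (τ b) (τ a)) := ⟨fun a b c h1 h2 => le_trans h2 h1⟩
  have tr' : IsTrans W (fun a b => S.le (τ a) (τ b)) := ⟨fun a b c h1 h2 => le_trans h1 h2⟩
  obtain ⟨g, hg | hg⟩ := exists_increasing_or_nonincreasing_subseq (fun a b => S.le (τ b) (τ a)) u
  · have hx' : x ∈ {x | S.le (τ x) (τ (u (g 0)))} := by
      refine (h.closed _).mem_of_tendsto (hu.comp g.strictMono.tendsto_atTop)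
        (Eventually.of_forall fun n => ?_)
      rcases Nat.eq_zero_or_pos n with rfl | hn
      · exact Or.inr rfl
      · exact hg 0 n hn
    exact hu' _ (le_trans hx hx')
  · obtain ⟨k, hk⟩ := exists_increasing_or_nonincreasing_subseq (fun a b => S.le (τ a) (τ b))
      (fun n => u (g n))
    have hg' : ∀ m n, m < n → ¬ S.le (τ (u (g (k n)))) (τ (u (g (k m)))) :=
      fun m n hmn => hg _ _ (k.strictMono hmn)
    have hp : PairwiseIncompOrStrictIncr S (fun n => τ (u (g (k n)))) := by
      rcases hk with hk | hk
      · right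
        intro m n hmn
        have h1 := hk m n hmn
        have h2 : τ (u (g (k m))) ≠ τ (u (g (k n))) := fun h => hg' m n hmn (Or.inr h.symm)
        exact ⟨h1.resolve_right h2, h2⟩
      · left
        intro m n hmn
        rcases lt_or_gt_of_ne hmn with hmn | hmn
        · exact hk m n hmn
        · exact hg' n m hmn
    have := h.rp1 q hq x (fun n => u (g (k n)))
      (hu.comp (g.strictMono.tendsto_atTop.comp k.strictMono.tendsto_atTop))
      (fun n hn => hu' _ (by rw [hn]; exact hx)) hx hp
    obtain ⟨n, hn⟩ := this.exists
    exact hu' _ hn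

theorem exists_min [T2Space W] (h : RankData S τ) {U : Set W} (hU : CO U) {x : W} (hx : x ∈ U) :
    ∃ y ∈ U, S.le (τ y) (τ x) ∧ Separated S (τ y) ∧ ∀ z ∈ U, S.le (τ z) (τ y) → τ z = τ y := by
  obtain ⟨⟨m, hmU, hmx⟩, hm⟩ := exists_maximal_of_chains_bounded (α := {y // y ∈ U ∧ S.le (τ y) (τ x)})
    (r := fun a b => S.le (τ b.1) (τ a.1)) (by
      intro c hc
      rcases c.eq_empty_or_nonempty with rfl | hne
      · exact ⟨⟨x, hx, Or.inr rfl⟩, by simp⟩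
      · have := hne.to_subtype
        have hcl : ∀ i : c, IsClosed (U ∩ {y | S.le (τ y) (τ i.1.1)}) :=
          fun i => hU.closed.inter (h.closed _)
        have mono : ∀ {a b : W}, S.le (τ a) (τ b) →
            (U ∩ {y | S.le (τ y) (τ a)}) ⊆ (U ∩ {y | S.le (τ y) (τ b)}) :=
          fun hab y hy => ⟨hy.1, le_trans hy.2 hab⟩
        obtain ⟨y, hy⟩ := IsCompact.nonempty_iInter_of_directed_nonempty_isCompact_isClosed
          (fun i : c => U ∩ {y | S.le (τ y) (τ i.1.1)}) (by
            intro i j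
            by_cases hij : i = j
            · exact ⟨i, subset_rfl, hij ▸ subset_rfl⟩
            · rcases hc i.2 j.2 (fun h => hij (Subtype.ext h)) with hh | hh
              · exact ⟨j, mono hh, subset_rfl⟩
              · exact ⟨i, subset_rfl, mono hh⟩)
          (fun i => ⟨i.1.1, i.1.2.1, Or.inr rfl⟩)
          (fun i => hU.1.of_isClosed_subset (hcl i) inter_subset_left) hcl
        rw [mem_iInter] at hy
        obtain ⟨i⟩ := this
        exact ⟨⟨y, (hy i).1, le_trans (hy i).2 i.1.2.2⟩, fun a ha => (hy ⟨a, ha⟩).2⟩)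
    (fun h1 h2 => le_trans h2 h1)
  have hmin : ∀ z ∈ U, S.le (τ z) (τ m) → τ z = τ m := by
    intro z hz hzm
    exact po_le_antisymm hzm (hm ⟨z, hz, le_trans hzm hmx⟩ hzm)
  refine ⟨m, hmU, hmx, ?_, hmin⟩
  by_contra hs
  obtain ⟨u, hu, hu'⟩ := h.rp2 m hs
  obtain ⟨k, hk⟩ := (hu.eventually (hU.2.mem_nhds hmU)).exists
  exact (hu' k).2 (hmin _ hk (Or.inl (hu' k).1))

end RankData

/-- trim sets -/
structure Trm (S : POSystem P) (τ : W → P) (A : Set W) (p : P) : Prop where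
  co : CO A
  sep : Separated S p
  ex : ∃ x ∈ A, τ x = p
  ge : ∀ y ∈ A, S.le p (τ y)
  un : ¬ S.lt p p → ∀ x ∈ A, ∀ y ∈ A, τ x = p → τ y = p → x = y

inductive Good (S : POSystem P) (τ : W → P) : Set W → Prop
  | empty : Good S τ ∅
  | add {A p A'} : Trm S τ A p → Good S τ A' → Disjoint A A' → Good S τ (A ∪ A')

inductive TR (S : POSystem P) (τ : W → P) : Set W → Set W → Prop
  | empty : TR S τ ∅ ∅
  | add {A B p A' B'} : Trm S τ A p → Trm S τ B p → TR S τ A' B' → Disjoint A A' → Disjoint B B' →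
      TR S τ (A ∪ A') (B ∪ B')

theorem TR.symm {A B : Set W} (h : TR S τ A B) : TR S τ B A := by
  induction h with
  | empty => exact .empty
  | add h1 h2 _ h4 h5 ih => exact .add h2 h1 ih h5 h4

theorem TR.co {A B : Set W} (h : TR S τ A B) : CO A ∧ CO B := by
  induction h with
  | empty => exact ⟨CO.empty, CO.empty⟩
  | add h1 h2 _ h4 h5 ih => exact ⟨h1.co.union ih.1, h2.co.union ih.2⟩

theorem TR.ne {A B : Set W} (h : TR S τ A B) : A.Nonempty ↔ B.Nonempty := by
  induction h with
  | empty => simp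
  | add h1 h2 _ h4 h5 ih =>
    obtain ⟨x, hx, _⟩ := h1.ex
    obtain ⟨y, hy, _⟩ := h2.ex
    exact ⟨fun _ => ⟨y, Or.inl hy⟩, fun _ => ⟨x, Or.inl hx⟩⟩

theorem TR.union {A B A' B' : Set W} (h : TR S τ A B) (h' : TR S τ A' B') (hd : Disjoint A A')
    (hd' : Disjoint B B') : TR S τ (A ∪ A') (B ∪ B') := by
  induction h with
  | empty => simpa using h'
  | add h1 h2 _ h4 h5 ih =>
    rw [union_assoc, union_assoc]
    rw [disjoint_union_left] at hd hd'
    exact .add h1 h2 (ih hd.2 hd'.2) (disjoint_union_right.2 ⟨h4, hd.1⟩)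
      (disjoint_union_right.2 ⟨h5, hd'.1⟩)

theorem TR.single {A B : Set W} {p : P} (h : Trm S τ A p) (h' : Trm S τ B p) : TR S τ A B := by
  have := TR.add h h' .empty (disjoint_empty A) (disjoint_empty B)
  simpa using this

theorem Trm.sub {A B : Set W} {p : P} (h : Trm S τ A p) (hB : CO B) (hBA : B ⊆ A)
    (hx : ∃ x ∈ B, τ x = p) : Trm S τ B p :=
  ⟨hB, h.sep, hx, fun y hy => h.ge y (hBA hy), fun hp x hx y hy => h.un hp x (hBA hx) y (hBA hy)⟩

variable [SecondCountableTopology W] [LocallyCompactSpace W] [T2Space W]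
    [TotallyDisconnectedSpace W]

theorem RankData.good (h : RankData S τ) {U : Set W} (hU : CO U) : Good S τ U := by
  classical
  -- finite set of centres
  have hmin : ∀ x : U, ∃ y ∈ U, S.le (τ y) (τ x) ∧ Separated S (τ y) ∧
    ∀ z ∈ U, S.le (τ z) (τ y) → τ z = τ y := fun x => h.exists_min hU x.2
  choose m hmU hmx hms hmm using hmin
  obtain ⟨t, ht⟩ := hU.1.elim_finite_subcover (fun x : U => {y | S.le (τ (m x)) (τ y)})
    (fun x => h.rp1' (hms x)) (fun x hx => mem_iUnion.2 ⟨⟨x, hx⟩, hmx ⟨x, hx⟩⟩)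
  have fin : ∀ x : U, ∃ F : Set W, F.Finite ∧ F ⊆ U ∧ m x ∈ F ∧ (∀ z ∈ F, τ z = τ (m x)) ∧
      (¬ S.lt (τ (m x)) (τ (m x)) → ∀ y ∈ U, τ y = τ (m x) → y ∈ F) := by
    intro x
    by_cases hx : S.lt (τ (m x)) (τ (m x))
    · exact ⟨{m x}, finite_singleton _, by simpa using hmU x, rfl, by simp, fun h => absurd hx h⟩
    · refine ⟨U ∩ {y | τ y = τ (m x)}, ?_, inter_subset_left, ⟨hmU x, rfl⟩, fun z hz => hz.2,
        fun _ y hy hy' => ⟨hy, hy'⟩⟩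
      by_contra hinf
      obtain ⟨z, hz, hacc⟩ := Set.Infinite.exists_accPt_of_subset_isCompact hinf hU.1 inter_subset_left
      have hz' : z ∈ limitPts {y | τ y = τ (m x)} := by
        rw [accPt_principal_iff_clusterPt, ← mem_closure_iff_clusterPt] at hacc
        exact closure_mono (sdiff_subset_sdiff_left inter_subset_right) hacc
      rw [h.lim] at hz'
      have := hmm x z hz (Or.inl hz')
      rw [this] at hz'
      exact hx hz'
  choose F hF hFU hmF hFτ hFd using fin
  let Zs : Set W := ⋃ x ∈ t, F x
  have hZf : Zs.Finite := t.finite_toSet.biUnion (fun x _ => hF x)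
  have hZmem : ∀ z, z ∈ hZf.toFinset ↔ ∃ x ∈ t, z ∈ F x := by
    intro z; simp [Zs]
  generalize hZf.toFinset = Z at hZmem
  have hZ1 : ∀ z ∈ Z, z ∈ U ∧ Separated S (τ z) ∧
      (¬ S.lt (τ z) (τ z) → ∀ y ∈ U, τ y = τ z → y ∈ Z) := by
    intro z hz
    obtain ⟨x, hx, hzx⟩ := (hZmem z).1 hz
    refine ⟨hFU x hzx, by rw [hFτ x z hzx]; exact hms x, fun hl y hy hyz => ?_⟩
    rw [hFτ x z hzx] at hl hyz
    exact (hZmem y).2 ⟨x, hx, hFd x hl y hy hyz⟩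
  have hZ2 : ∀ y ∈ U, ∃ z ∈ Z, S.le (τ z) (τ y) := by
    intro y hy
    obtain ⟨x, hx, hyx⟩ := mem_iUnion₂.1 (ht hy)
    exact ⟨m x, (hZmem _).2 ⟨x, hx, hmF x⟩, hyx⟩
  let O : W → Set W := fun z => if z ∈ Z then {y | S.le (τ z) (τ y)} \ (↑(Z.erase z) : Set W) else ∅
  have hO : ∀ z, IsOpen (O z) := by
    intro z
    by_cases hz : z ∈ Z
    · simp only [O, hz, if_true]
      exact (h.rp1' (hZ1 z hz).2.1).sdiff (Finset.finite_toSet _).isClosed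
    · simp only [O, hz, if_false]; exact isOpen_empty
  have hOm : ∀ z ∈ Z, ∀ y, y ∈ O z ↔ S.le (τ z) (τ y) ∧ (y ∈ Z → y = z) := by
    intro z hz y
    simp only [O, hz, if_true]
    simp only [Set.mem_sdiff, mem_ofPred_eq, Finset.mem_coe, Finset.mem_erase]
    tauto
  obtain ⟨V, hV1, hV2, hV3, hV4⟩ := exists_clopen_refine Z O hO U hU (by
    intro y hy
    by_cases hyZ : y ∈ Z
    · exact ⟨y, hyZ, (hOm y hyZ y).2 ⟨Or.inr rfl, fun _ => rfl⟩⟩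
    · obtain ⟨z, hz, hzy⟩ := hZ2 y hy
      exact ⟨z, hz, (hOm z hz y).2 ⟨hzy, fun h => absurd h hyZ⟩⟩)
  have hVU : ∀ z ∈ Z, V z ⊆ U := fun z hz => by rw [hV4]; exact subset_biUnion_of_mem (u := V) hz
  have htrim : ∀ z ∈ Z, Trm S τ (V z) (τ z) := by
    intro z hz
    refine ⟨hV1 z, (hZ1 z hz).2.1, ⟨z, ?_, rfl⟩, fun y hy => ((hOm z hz y).1 (hV2 z hz hy)).1, ?_⟩
    · have := (hZ1 z hz).1
      rw [hV4] at this
      obtain ⟨z', hz', hzz⟩ := mem_iUnion₂.1 this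
      have := ((hOm z' hz' z).1 (hV2 z' hz' hzz)).2 hz
      rwa [this] at hzz ⊢
    · have key : ¬ S.lt (τ z) (τ z) → ∀ x ∈ V z, τ x = τ z → x = z := fun hl x hx hxz =>
        ((hOm z hz x).1 (hV2 z hz hx)).2 ((hZ1 z hz).2.2 hl x (hVU z hz hx) hxz)
      intro hl x hx y hy hxz hyz
      rw [key hl x hx hxz, key hl y hy hyz]
  have fin : ∀ Z' : Finset W, Z' ⊆ Z → Good S τ (⋃ z ∈ Z', V z) := by
    intro Z'
    induction Z' using Finset.induction_on with
    | empty => intro _; simpa using Good.empty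
    | insert a Z' ha ih =>
      intro hs
      rw [Finset.set_biUnion_insert]
      refine .add (htrim a (hs (Finset.mem_insert_self _ _)))
        (ih ((Finset.subset_insert _ _).trans hs)) ?_
      rw [disjoint_iUnion₂_right]
      intro z hz
      exact hV3 a (hs (Finset.mem_insert_self _ _)) z (hs (Finset.mem_insert_of_mem hz))
        (fun h => ha (h ▸ hz))
  rw [hV4]
  exact fin Z subset_rfl

theorem RankData.absorb (h : RankData S τ) {B : Set W} {p r : P} (hB : Trm S τ B p)
    (hr : Separated S r) (hpr : S.lt p r) : ∃ F ⊆ B, Trm S τ F r ∧ Trm S τ (B \ F) p := by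
  obtain ⟨y, hyB, rfl⟩ := hB.ex
  have hy : y ∈ limitPts {x | τ x = r} := (h.lim y r).2 hpr
  obtain ⟨y', hy'B, hy'r, hne⟩ := mem_closure_iff.1 hy B hB.co.2 hyB
  have hy'r : τ y' = r := hy'r
  have hnb : ∃ N ∈ 𝓝 y', ¬ S.lt r r → ∀ x ∈ N, τ x = r → x = y' := by
    by_cases hl : S.lt r r
    · exact ⟨univ, univ_mem, fun h => absurd hl h⟩
    · have : y' ∉ limitPts {x | τ x = r} := by rw [h.lim, hy'r]; exact hl
      refine ⟨(closure ({x | τ x = r} \ {y'}))ᶜ, isClosed_closure.isOpen_compl.mem_nhds this, ?_⟩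
      intro _ x hx hxr
      by_contra hxy
      exact hx (subset_closure ⟨hxr, hxy⟩)
  obtain ⟨N, hN, hN'⟩ := hnb
  have h1 : {x | S.le r (τ x)} ∈ 𝓝 y' := (h.rp1' hr).mem_nhds (Or.inr hy'r.symm)
  have h2 : B \ {y} ∈ 𝓝 y' := (hB.co.2.sdiff isClosed_singleton).mem_nhds ⟨hy'B, hne⟩
  obtain ⟨F, hF, hyF, hFs⟩ := exists_CO (inter_mem hN (inter_mem h1 h2))
  refine ⟨F, fun x hx => (hFs hx).2.2.1, ⟨hF, hr, ⟨y', hyF, hy'r⟩, fun x hx => (hFs hx).2.1, ?_⟩, ?_⟩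
  · intro hl x hx z hz hxr hzr
    rw [hN' hl x (hFs hx).1 hxr, hN' hl z (hFs hz).1 hzr]
  · exact hB.sub (hB.co.diff hF) sdiff_subset ⟨y, ⟨hyB, fun hy => (hFs hy).2.2.2 rfl⟩, rfl⟩

theorem RankData.absorbGood (h : RankData S τ) {C : Set W} (hC : Good S τ C) {p : P} :
    ∀ {B : Set W}, Trm S τ B p → (∀ y ∈ C, S.lt p (τ y)) → ∃ D ⊆ B, TR S τ C D ∧ Trm S τ (B \ D) p := by
  induction hC with
  | empty =>
    intro B hB _
    exact ⟨∅, empty_subset _, .empty, by simpa using hB⟩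
  | @add A r A' h1 _ h3 ih =>
    intro B hB hp
    obtain ⟨x, hx, hxr⟩ := h1.ex
    obtain ⟨F, hFB, hF, hBF⟩ := h.absorb hB h1.sep (hxr ▸ hp x (Or.inl hx))
    obtain ⟨D, hD, hT, hBD⟩ := ih hBF (fun y hy => hp y (Or.inr hy))
    refine ⟨F ∪ D, union_subset hFB (hD.trans sdiff_subset), .add h1 hF hT h3 ?_, ?_⟩
    · exact Set.disjoint_left.2 fun y hy hy' => (hD hy').2 hy
    · rwa [← sdiff_sdiff]

theorem RankData.splitTrm (h : RankData S τ) {A B : Set W} {p : P} (hA : Trm S τ A p)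
    (hB : Trm S τ B p) {U : Set W} (hU : CO U) :
    ∃ D, TR S τ (A ∩ U) (B ∩ D) ∧ TR S τ (A \ U) (B \ D) := by
  have key : ∀ C C' : Set W, CO C → CO C' → C ⊆ A → C' ⊆ A → Disjoint C C' → (∃ x ∈ C, τ x = p) →
      ∃ D ⊆ B, TR S τ C (B \ D) ∧ TR S τ C' D := by
    rintro C C' hC hC' hCA hCA' hd ⟨x, hx, hxp⟩
    obtain ⟨D, hDB, hT, hBD⟩ := h.absorbGood (h.good hC') hB (by
      intro y hy
      rcases hA.ge y (hCA' hy) with hl | hl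
      · exact hl
      · by_contra hcon
        rw [← hl] at hcon
        have := hA.un hcon x (hCA hx) y (hCA' hy) hxp hl.symm
        subst this
        exact Set.disjoint_left.1 hd hx hy)
    exact ⟨D, hDB, TR.single (hA.sub hC hCA ⟨x, hx, hxp⟩) hBD, hT⟩
  obtain ⟨x, hx, hxp⟩ := hA.ex
  have h1 := hA.co.inter hU
  have h2 := hA.co.diff hU
  have hd : Disjoint (A ∩ U) (A \ U) := disjoint_sdiff_inter.symm
  by_cases hxU : x ∈ U
  · obtain ⟨D, hDB, hT, hT'⟩ := key _ _ h1 h2 inter_subset_left sdiff_subset hd ⟨x, ⟨hx, hxU⟩, hxp⟩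
    refine ⟨B \ D, ?_, ?_⟩
    · rwa [inter_eq_right.2 sdiff_subset]
    · rwa [sdiff_sdiff_cancel_left hDB]
  · obtain ⟨D, hDB, hT, hT'⟩ := key _ _ h2 h1 sdiff_subset inter_subset_left hd.symm ⟨x, ⟨hx, hxU⟩, hxp⟩
    refine ⟨D, ?_, hT⟩
    rwa [inter_eq_right.2 hDB]

theorem RankData.splitTR (h : RankData S τ) {A B : Set W} (hAB : TR S τ A B) {U : Set W} (hU : CO U) :
    ∃ D, TR S τ (A ∩ U) (B ∩ D) ∧ TR S τ (A \ U) (B \ D) := by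
  induction hAB with
  | empty => exact ⟨∅, by simpa using TR.empty, by simpa using TR.empty⟩
  | @add A B p A' B' h1 h2 _ h4 h5 ih =>
    obtain ⟨D', hD1, hD2⟩ := ih
    obtain ⟨D, hD3, hD4⟩ := h.splitTrm h1 h2 hU
    have h5' := Set.disjoint_left.1 h5
    refine ⟨(B ∩ D) ∪ (B' ∩ D'), ?_, ?_⟩
    · have e1 : (A ∪ A') ∩ U = A ∩ U ∪ A' ∩ U := union_inter_distrib_right _ _ _
      have e2 : (B ∪ B') ∩ (B ∩ D ∪ B' ∩ D') = B ∩ D ∪ B' ∩ D' := by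
        ext x; simp only [mem_inter_iff, mem_union]; tauto
      rw [e1, e2]
      exact hD3.union hD1 (h4.mono inter_subset_left inter_subset_left)
        (h5.mono inter_subset_left inter_subset_left)
    · have e1 : (A ∪ A') \ U = A \ U ∪ A' \ U := union_sdiff_distrib
      have e2 : (B ∪ B') \ (B ∩ D ∪ B' ∩ D') = B \ D ∪ B' \ D' := by
        ext x; simp only [mem_inter_iff, mem_union, Set.mem_sdiff]
        have := @h5' x
        tauto
      rw [e1, e2]
      exact hD4.union hD2 (h4.mono sdiff_subset sdiff_subset) (h5.mono sdiff_subset sdiff_subset)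

theorem RankData.iso (h : RankData S τ) {A B : Set W} (hAB : TR S τ A B) : Iso A B := by
  obtain ⟨e, h1, h2, -⟩ := vaught (TR S τ) (fun _ _ h => h.co) (fun _ _ h => h.ne)
    (fun A B hAB U hU => h.splitTR hAB hU) (fun A B hAB U hU => by
      obtain ⟨D, h1, h2⟩ := h.splitTR hAB.symm hU
      exact ⟨D, h1.symm, h2.symm⟩) hAB
  exact ⟨e, h1, h2⟩

theorem RankData.pi (h : RankData S τ) {A : Set W} {p : P} (hA : Trm S τ A p) : IsPISet A := by
  refine ⟨hA.co.1, hA.co.2, fun B hB hB' hBA => ?_⟩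
  obtain ⟨x, hx, hxp⟩ := hA.ex
  by_cases hxB : x ∈ B
  · left
    exact (h.iso (TR.single (hA.sub ⟨hB, hB'⟩ hBA ⟨x, hxB, hxp⟩) hA)).idealIso
  · right
    exact (h.iso (TR.single (hA.sub (hA.co.diff ⟨hB, hB'⟩) sdiff_subset ⟨x, ⟨hx, hxB⟩, hxp⟩) hA)).idealIso

theorem RankData.primitive (h : RankData S τ) : PrimitiveSpace W := by
  intro A hA hA'
  have := h.good ⟨hA, hA'⟩
  clear hA hA'
  induction this with
  | empty => exact ⟨0, Fin.elim0, fun i => i.elim0, fun i => i.elim0, by simp⟩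
  | @add A p A' h1 h2 h3 ih =>
    obtain ⟨n, F, hF, hd, rfl⟩ := ih
    rw [disjoint_iUnion_right] at h3
    refine ⟨n + 1, Fin.cons A F, ?_, ?_, ?_⟩
    · intro i
      refine Fin.cases ?_ (fun i => ?_) i
      · exact h.pi h1
      · exact hF i
    · intro i j
      refine Fin.cases ?_ (fun i => ?_) i
      · refine Fin.cases ?_ (fun j => ?_) j
        · exact fun h => absurd rfl h
        · exact fun _ => h3 j
      · refine Fin.cases ?_ (fun j => ?_) j
        · exact fun _ => (h3 i).symm
        · exact fun hij => hd (fun h => hij (congrArg Fin.succ h))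
    · ext x
      simp

end RankToPrim

section PrimToOrbit
variable {W : Type u} [TopologicalSpace W]

/-- absorption -/
def AbS (A B : Set W) : Prop := ∃ B' ⊆ A, CO B' ∧ Iso B' B ∧ Iso (A \ B') A

/-- the order on PI sets -/
def LeS (A B : Set W) : Prop := Iso A B ∨ AbS A B

theorem Iso.isOpen_left {A B : Set W} (h : Iso A B) : IsOpen A := by
  obtain ⟨e, rfl, rfl⟩ := h; exact e.open_source

theorem LeS.trans {A B C : Set W} (h1 : LeS A B) (h2 : LeS B C) : LeS A C := by
  rcases h1 with h1 | ⟨B', hB'A, hB', hB'B, hAB'⟩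
  · rcases h2 with h2 | ⟨C', hC'B, hC', hC'C, hBC'⟩
    · exact Or.inl (h1.trans h2)
    · right
      obtain ⟨D, hD, i1, i2⟩ := h1.symm.split hC'.2 hBC'.isOpen_left hC'B
      exact ⟨D, hD, i1.CO hC', i1.symm.trans hC'C, i2.symm.trans (hBC'.trans h1.symm)⟩
  · rcases h2 with h2 | ⟨C', hC'B, hC', hC'C, hBC'⟩
    · exact Or.inr ⟨B', hB'A, hB', hB'B.trans h2, hAB'⟩
    · right
      obtain ⟨D, hD, i1, i2⟩ := hB'B.symm.split hC'.2 hBC'.isOpen_left hC'B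
      refine ⟨D, hD.trans hB'A, i1.CO hC', i1.symm.trans hC'C, ?_⟩
      have i3 : Iso (B' \ D) B' := i2.symm.trans (hBC'.trans hB'B.symm)
      have i4 := (Iso.refl hAB'.isOpen_left).union i3
        (disjoint_sdiff_left.mono_right sdiff_subset) disjoint_sdiff_left
      have e1 : (A \ B') ∪ (B' \ D) = A \ D := by
        ext x
        have h1 := @hD x
        have h2 := @hB'A x
        simp only [mem_union, Set.mem_sdiff]; tauto
      rwa [e1, sdiff_union_of_subset hB'A] at i4

theorem LeS.copy {A B : Set W} (h : LeS A B) (hA : CO A) : ∃ B' ⊆ A, CO B' ∧ Iso B' B := by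
  rcases h with h | ⟨B', h1, h2, h3, _⟩
  · exact ⟨A, subset_rfl, hA, h⟩
  · exact ⟨B', h1, h2, h3⟩

theorem IsPISet.co {A : Set W} (h : IsPISet A) : CO A := ⟨h.1, h.2.1⟩

theorem oph_union (e f : OpenPartialHomeomorph W W) (hs : Disjoint e.source f.source)
    (ht : Disjoint e.target f.target) : ∃ g : OpenPartialHomeomorph W W,
      g.source = e.source ∪ f.source ∧ g.target = e.target ∪ f.target ∧
      ∀ x ∈ e.source, g x = e x := by
  classical
  refine ⟨e.disjointUnion f hs ht, rfl, rfl, fun x hx => ?_⟩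
  show e.source.piecewise e f x = e x
  exact piecewise_eq_of_mem _ _ _ hx

/-- same orbit -/
def Orb (w x : W) : Prop := ∃ h : W ≃ₜ W, h w = x

theorem Orb.refl (w : W) : Orb w w := (homeoSetoid W).iseqv.refl w
theorem Orb.symm {w x : W} (h : Orb w x) : Orb x w := (homeoSetoid W).iseqv.symm h
theorem Orb.trans {w x y : W} (h : Orb w x) (h' : Orb x y) : Orb w y :=
  (homeoSetoid W).iseqv.trans h h'

/-- `w` has a neighbourhood of type `A` -/
def InS (A : Set W) (w : W) : Prop := ∃ B, CO B ∧ w ∈ B ∧ Iso A B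

theorem InS.orb {A : Set W} {w x : W} (h : InS A w) (ho : Orb w x) : InS A x := by
  obtain ⟨B, hB, hw, hi⟩ := h
  obtain ⟨h, rfl⟩ := ho
  obtain ⟨f, hf, hf', _⟩ := oph_sub h.toOpenPartialHomeomorph hB.2 (by simp)
  have hi' : Iso B (h '' B) := ⟨f, hf, by rw [hf']; rfl⟩
  exact ⟨h '' B, hi'.CO hB, mem_image_of_mem _ hw, hi.trans hi'⟩

theorem InS.iso {A B : Set W} {w : W} (h : InS A w) (hi : Iso A B) : InS B w := by
  obtain ⟨C, h1, h2, h3⟩ := h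
  exact ⟨C, h1, h2, hi.symm.trans h3⟩

/-- order of points by types of neighbourhoods -/
def Lx (w x : W) : Prop := ∀ A : Set W, IsPISet A → InS A w → InS A x

theorem Lx.trans {w x y : W} (h : Lx w x) (h' : Lx x y) : Lx w y :=
  fun A hA hw => h' A hA (h A hA hw)

theorem CO.inS {A : Set W} (h : CO A) {w : W} (hw : w ∈ A) : InS A w := ⟨A, h, hw, Iso.refl h.2⟩

theorem lim_inv {w w' x : W} (ho : Orb w w') (h : w ∈ limitPts {y | Orb y x}) :
    w' ∈ limitPts {y | Orb y x} := by
  obtain ⟨h', rfl⟩ := ho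
  refine mem_closure_iff.2 fun U hU hw => ?_
  obtain ⟨y, hy, hyx, hne⟩ := mem_closure_iff.1 h (h' ⁻¹' U) (hU.preimage h'.continuous) hw
  refine ⟨h' y, hy, ?_, ?_⟩
  · exact Orb.trans (Orb.symm ⟨h', rfl⟩) hyx
  · exact fun he => hne (h'.injective he)

theorem lim_trans [T2Space W] {w x y : W} (h : w ∈ limitPts {y | Orb y x}) (h' : x ∈ limitPts {z | Orb z y}) :
    w ∈ limitPts {z | Orb z y} := by
  refine mem_closure_iff.2 fun U hU hw => ?_
  obtain ⟨x', hx'U, hx', hne⟩ := mem_closure_iff.1 h U hU hw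
  have := lim_inv (Orb.symm hx') h'
  obtain ⟨z, hz, hz', _⟩ := mem_closure_iff.1 this (U \ {w}) (hU.sdiff isClosed_singleton) ⟨hx'U, hne⟩
  exact ⟨z, hz.1, hz', hz.2⟩

section T2
variable [T2Space W]

theorem orb_of_oph [LocallyCompactSpace W] [TotallyDisconnectedSpace W]
    (e : OpenPartialHomeomorph W W) {w : W} (hw : w ∈ e.source) : Orb w (e w) := by
  by_cases hne : e w = w
  · rw [hne]; exact Orb.refl w
  obtain ⟨U, V, hU, hV, hwU, hwV, hUV⟩ := t2_separation (Ne.symm hne)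
  have h1 : e ⁻¹' V ∈ 𝓝 w := (e.continuousAt hw).preimage_mem_nhds (hV.mem_nhds hwV)
  obtain ⟨A, hA, hwA, hAs⟩ := exists_CO (inter_mem (hU.mem_nhds hwU)
    (inter_mem (e.open_source.mem_nhds hw) h1))
  obtain ⟨f, hf, hf', hfe⟩ := oph_sub e hA.2 (fun x hx => (hAs hx).2.1)
  have hd : Disjoint f.source f.target := by
    rw [hf, hf']
    refine hUV.mono (fun x hx => (hAs hx).1) ?_
    rintro _ ⟨x, hx, rfl⟩
    exact (hAs hx).2.2
  have hB : CO f.target := Iso.CO ⟨f, rfl, rfl⟩ (hf ▸ hA)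
  have hA' : CO f.source := hf ▸ hA
  obtain ⟨g, hg, hg', hgf⟩ := oph_union f f.symm hd hd.symm
  have hgg : g.target = g.source := by
    rw [hg, hg']; exact union_comm _ _
  have hgc : CO g.source := by rw [hg]; exact hA'.union hB
  obtain ⟨k, hk, hk', hkg⟩ := oph_union g (OpenPartialHomeomorph.ofSet g.sourceᶜ hgc.closed.isOpen_compl)
    (by exact disjoint_compl_right) (by rw [hgg]; exact disjoint_compl_right)
  have hk1 : k.source = univ := by rw [hk]; exact union_compl_self _
  have hk2 : k.target = univ := by rw [hk', hgg]; exact union_compl_self _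
  refine ⟨k.toHomeomorphOfSourceEqUnivTargetEqUniv hk1 hk2, ?_⟩
  have hwf : w ∈ f.source := hf ▸ hwA
  show k w = e w
  rw [hkg w (by rw [hg]; exact Or.inl hwf), hgf w hwf, hfe]

theorem LeS.antisymm {A B : Set W} (h1 : LeS A B) (h2 : LeS B A) : Iso A B := by
  rcases h1 with h1 | ⟨B', hB'A, hB', hB'B, hAB'⟩
  · exact h1
  rcases h2 with h2 | ⟨A', hA'B, hA', hA'A, hBA'⟩
  · exact h2.symm
  have := (hB'B.trans hBA'.symm).union (hAB'.trans hA'A.symm) disjoint_sdiff_right disjoint_sdiff_left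
  rwa [union_sdiff_cancel hB'A, sdiff_union_of_subset hA'B] at this

end T2

variable [SecondCountableTopology W] [LocallyCompactSpace W] [T2Space W]
    [TotallyDisconnectedSpace W]

theorem IsPISet.alt {A B : Set W} (h : IsPISet A) (hB : CO B) (hBA : B ⊆ A) :
    Iso B A ∨ Iso (A \ B) A := by
  rcases h.2.2 B hB.1 hB.2 hBA with h1 | h1
  · exact Or.inl (h1.iso hB h.co)
  · exact Or.inr (h1.iso (h.co.diff hB) h.co)

theorem IsPISet.of_iso {A B : Set W} (h : IsPISet A) (hAB : Iso A B) : IsPISet B := by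
  have hB := hAB.CO h.co
  refine ⟨hB.1, hB.2, fun C hC hC' hCB => ?_⟩
  obtain ⟨D, hD, h1, h2⟩ := hAB.symm.split hC' (hB.diff ⟨hC, hC'⟩).2 hCB
  rcases h.alt (h1.CO ⟨hC, hC'⟩) hD with h3 | h3
  · left; exact (h1.trans (h3.trans hAB)).idealIso
  · right; exact (h2.trans (h3.trans hAB)).idealIso

theorem IsPISet.le {A B : Set W} (h : IsPISet A) (hB : CO B) (hBA : B ⊆ A) : LeS A B := by
  rcases h.alt hB hBA with h1 | h1
  · exact Or.inl h1.symm
  · exact Or.inr ⟨B, hBA, hB, Iso.refl hB.2, h1⟩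

theorem InS.pt {A : Set W} {x : W} (h : InS A x) : ∃ x' ∈ A, Orb x' x := by
  obtain ⟨C, hC, hx, e, rfl, rfl⟩ := h
  refine ⟨e.symm x, e.map_target hx, ?_⟩
  exact Orb.symm (orb_of_oph e.symm hx)

theorem LeS.inS {A B : Set W} (h : LeS A B) (hA : CO A) {x : W} (hx : InS B x) : InS A x := by
  obtain ⟨B', h1, h2, h3⟩ := h.copy hA
  obtain ⟨x', hx', ho⟩ := (hx.iso h3.symm).pt
  exact (hA.inS (h1 hx')).orb ho

theorem exists_PI (hP : PrimitiveSpace W) {x : W} {U : Set W} (hU : U ∈ 𝓝 x) :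
    ∃ H, IsPISet H ∧ x ∈ H ∧ H ⊆ U := by
  obtain ⟨A, hA, hx, hAU⟩ := exists_CO hU
  obtain ⟨n, F, hF, -, rfl⟩ := hP A hA.1 hA.2
  obtain ⟨i, hi⟩ := mem_iUnion.1 hx
  exact ⟨F i, hF i, hi, (subset_iUnion F i).trans hAU⟩

theorem exists_PI_le (hP : PrimitiveSpace W) {x : W} {U B : Set W} (hU : U ∈ 𝓝 x) (hB : IsPISet B)
    (hx : InS B x) : ∃ H, IsPISet H ∧ x ∈ H ∧ H ⊆ U ∧ LeS B H := by
  obtain ⟨C, hC, hxC, hi⟩ := hx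
  obtain ⟨H, hH, hxH, hs⟩ := exists_PI hP (inter_mem (hC.2.mem_nhds hxC) hU)
  exact ⟨H, hH, hxH, hs.trans inter_subset_right,
    LeS.trans (Or.inl hi) ((hB.of_iso hi).le hH.co (hs.trans inter_subset_left))⟩

theorem swap_aux (hP : PrimitiveSpace W) {B₁ B₂ : Set W} (h1 : CO B₁) (h2 : CO B₂)
    (hd : Disjoint B₁ B₂) {y x : W} (hy : y ∈ B₁) (hx : x ∈ B₂) (hyx : Lx y x) :
    ∃ D₁ D₂ : Set W, CO D₁ ∧ CO D₂ ∧ Disjoint D₁ D₂ ∧ D₁ ∪ D₂ = B₁ ∪ B₂ ∧ Iso B₁ D₁ ∧ Iso B₂ D₂ ∧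
      x ∈ D₁ := by
  obtain ⟨G, hG, hyG, hGB⟩ := exists_PI hP (h1.2.mem_nhds hy)
  obtain ⟨H, hH, hxH, hHB, hGH⟩ := exists_PI_le hP (h2.2.mem_nhds hx) hG (hyx G hG (hG.co.inS hyG))
  obtain ⟨G', hG', hGc, hi⟩ := hGH.copy hG.co
  have hG'B := hG'.trans hGB
  have hdd := Set.disjoint_left.1 hd
  have i1 : Iso ((B₁ \ G') ∪ G') ((B₁ \ G') ∪ H) := (Iso.refl (h1.diff hGc).2).union hi
    disjoint_sdiff_left (hd.mono sdiff_subset hHB)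
  have i2 : Iso ((B₂ \ H) ∪ H) ((B₂ \ H) ∪ G') := (Iso.refl (h2.diff hH.co).2).union hi.symm
    disjoint_sdiff_left (hd.symm.mono sdiff_subset hG'B)
  rw [sdiff_union_of_subset hG'B] at i1
  rw [sdiff_union_of_subset hHB] at i2
  refine ⟨_, _, i1.CO h1, i2.CO h2, ?_, ?_, i1, i2, Or.inr hxH⟩
  · refine Set.disjoint_left.2 fun z hz hz' => ?_
    have a1 := @hdd z
    have a2 := @hG'B z
    have a3 := @hHB z
    simp only [mem_union, Set.mem_sdiff] at hz hz'
    tauto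
  · ext z
    have a1 := @hdd z
    have a2 := @hG'B z
    have a3 := @hHB z
    simp only [mem_union, Set.mem_sdiff]
    tauto

/-- pointed back and forth relation -/
def PR (w x : W) (A B : Set W) : Prop := CO A ∧ CO B ∧ Iso A B ∧ (w ∈ A ↔ x ∈ B)

theorem PR.symm {w x : W} {A B : Set W} (h : PR w x A B) : PR x w B A :=
  ⟨h.2.1, h.1, h.2.2.1.symm, h.2.2.2.symm⟩

theorem PR.split (hP : PrimitiveSpace W) {w x : W} (hwx : Lx w x) {A B : Set W} (h : PR w x A B)
    {U : Set W} (hU : CO U) : ∃ D, PR w x (A ∩ U) (B ∩ D) ∧ PR w x (A \ U) (B \ D) := by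
  obtain ⟨hA, hB, ⟨e, he, he'⟩, hiff⟩ := h
  have c1 := hA.inter hU
  have c2 := hA.diff hU
  obtain ⟨f, hf, hf', -⟩ := oph_sub e c1.2 (he ▸ inter_subset_left)
  obtain ⟨g, hg, hg', -⟩ := oph_sub e c2.2 (he ▸ sdiff_subset)
  have i1 : Iso (A ∩ U) (e '' (A ∩ U)) := ⟨f, hf, hf'⟩
  have i2 : Iso (A \ U) (e '' (A \ U)) := ⟨g, hg, hg'⟩
  have hun : e '' (A ∩ U) ∪ e '' (A \ U) = B := by
    rw [← image_union, inter_union_sdiff, ← he, ← he', e.image_source_eq_target]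
  have hdj : Disjoint (e '' (A ∩ U)) (e '' (A \ U)) := by
    refine Set.disjoint_left.2 ?_
    rintro _ ⟨a, ha, rfl⟩ ⟨b, hb, hab⟩
    have : b = a := e.injOn (he ▸ hb.1) (he ▸ ha.1) hab
    exact hb.2 (this ▸ ha.2)
  have fin : ∀ D₁ D₂ : Set W, Disjoint D₁ D₂ → D₁ ∪ D₂ = B → Iso (A ∩ U) D₁ → Iso (A \ U) D₂ →
      (w ∈ A ∩ U ↔ x ∈ D₁) → (w ∈ A \ U ↔ x ∈ D₂) →
      ∃ D, PR w x (A ∩ U) (B ∩ D) ∧ PR w x (A \ U) (B \ D) := by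
    intro D₁ D₂ hd hu j1 j2 k1 k2
    refine ⟨D₁, ?_, ?_⟩
    · rw [← hu, union_inter_cancel_left]
      exact ⟨c1, j1.CO c1, j1, k1⟩
    · rw [← hu, union_sdiff_cancel_left hd.le_bot]
      exact ⟨c2, j2.CO c2, j2, k2⟩
  by_cases hwA : w ∈ A
  · have hxB := hiff.1 hwA
    have hew : Lx (e w) x := by
      intro E hE hEw
      exact hwx E hE (hEw.orb (Orb.symm (orb_of_oph e (he ▸ hwA))))
    by_cases hwU : w ∈ U
    · by_cases hx : x ∈ e '' (A ∩ U)
      · refine fin _ _ hdj hun i1 i2 ⟨fun _ => hx, fun _ => ⟨hwA, hwU⟩⟩ ⟨fun h => absurd hwU h.2,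
          fun h => absurd h (Set.disjoint_left.1 hdj hx)⟩
      · have hx' : x ∈ e '' (A \ U) := by
          rw [← hun] at hxB; exact hxB.resolve_left hx
        obtain ⟨D₁, D₂, d1, d2, d3, d4, d5, d6, d7⟩ := swap_aux hP (i1.CO c1) (i2.CO c2) hdj
          (mem_image_of_mem e (⟨hwA, hwU⟩ : w ∈ A ∩ U)) hx' hew
        refine fin D₁ D₂ d3 (d4.trans hun) (i1.trans d5) (i2.trans d6)
          ⟨fun _ => d7, fun _ => ⟨hwA, hwU⟩⟩ ⟨fun h => absurd hwU h.2,
          fun h => absurd h (Set.disjoint_left.1 d3 d7)⟩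
    · by_cases hx : x ∈ e '' (A \ U)
      · refine fin _ _ hdj hun i1 i2 ⟨fun h => absurd h.2 hwU, fun h =>
          absurd hx (Set.disjoint_left.1 hdj h)⟩ ⟨fun _ => hx, fun _ => ⟨hwA, hwU⟩⟩
      · have hx' : x ∈ e '' (A ∩ U) := by
          rw [← hun] at hxB; exact hxB.resolve_right hx
        obtain ⟨D₁, D₂, d1, d2, d3, d4, d5, d6, d7⟩ := swap_aux hP (i2.CO c2) (i1.CO c1) hdj.symm
          (mem_image_of_mem e (⟨hwA, hwU⟩ : w ∈ A \ U)) hx' hew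
        refine fin D₂ D₁ d3.symm ?_ (i1.trans d6) (i2.trans d5)
          ⟨fun h => absurd h.2 hwU, fun h => absurd h (Set.disjoint_left.1 d3 d7)⟩
          ⟨fun _ => d7, fun _ => ⟨hwA, hwU⟩⟩
        rw [union_comm, d4, union_comm, hun]
  · have hxB : x ∉ B := fun h => hwA (hiff.2 h)
    rw [← hun] at hxB
    exact fin _ _ hdj hun i1 i2 ⟨fun h => absurd h.1 hwA, fun h => absurd (Or.inl h) hxB⟩
      ⟨fun h => absurd h.1 hwA, fun h => absurd (Or.inr h) hxB⟩

theorem orb_of_Lx (hP : PrimitiveSpace W) {w x : W} (h1 : Lx w x) (h2 : Lx x w) : Orb w x := by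
  obtain ⟨A, hA, hwA, -⟩ := exists_PI hP (univ_mem : univ ∈ 𝓝 w)
  obtain ⟨B, hB, hxB, hi⟩ := h1 A hA (hA.co.inS hwA)
  obtain ⟨e, he, -, hv⟩ := vaught (PR w x) (fun _ _ h => ⟨h.1, h.2.1⟩)
    (fun _ _ h => ⟨h.2.2.1.nonempty, h.2.2.1.symm.nonempty⟩)
    (fun A B hAB U hU => PR.split hP h1 hAB hU) (fun A B hAB U hU => by
      obtain ⟨D, h3, h4⟩ := PR.split hP h2 hAB.symm hU
      exact ⟨D, h3.symm, h4.symm⟩) (⟨hA.co, hB, hi, ⟨fun _ => hxB, fun _ => hwA⟩⟩ : PR w x A B)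
  have hex : e w = x := by
    by_contra hne
    obtain ⟨C, D, hR, hwC, -, hDV⟩ := hv w hwA {x}ᶜ (isOpen_compl_singleton.mem_nhds hne)
    exact hDV (hR.2.2.2.1 hwC) rfl
  rw [← hex]
  exact orb_of_oph e (he ▸ hwA)

theorem lx_iff (hP : PrimitiveSpace W) {w x : W} :
    Lx w x ↔ w ∈ limitPts {y | Orb y x} ∨ Orb w x := by
  constructor
  · intro h
    by_cases ho : Orb w x
    · exact Or.inr ho
    · left
      refine mem_closure_iff.2 fun U hU hw => ?_
      obtain ⟨A, hA, hwA, hAU⟩ := exists_PI hP (hU.mem_nhds hw)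
      obtain ⟨x', hx', hox⟩ := (h A hA (hA.co.inS hwA)).pt
      exact ⟨x', hAU hx', hox, fun he => ho (he ▸ hox)⟩
  · rintro (h | h) A hA hw
    · obtain ⟨B, hB, hwB, hi⟩ := hw
      obtain ⟨y, hy, hyx, -⟩ := mem_closure_iff.1 h B hB.2 hwB
      exact InS.orb ⟨B, hB, hy, hi⟩ hyx
    · exact hw.orb h

theorem exists_lim_pt (C : ℕ → Set W) (hC : ∀ n, IsPISet (C n)) (hne : ∀ n, (C n).Nonempty)
    (hle : ∀ n, LeS (C n) (C (n + 1))) :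
    ∃ v ∈ C 0, ∀ A, IsPISet A → (InS A v ↔ ∃ n, LeS A (C n)) := by
  obtain ⟨U, hU, hUs⟩ := exists_enum (W := W)
  have step : ∀ n (E : {E : Set W // IsPISet E ∧ Iso E (C n)}),
      ∃ E' : {E : Set W // IsPISet E ∧ Iso E (C (n + 1))}, E'.1 ⊆ E.1 ∧
        (E'.1 ⊆ U n ∨ Disjoint E'.1 (U n)) := by
    rintro n ⟨E, hE, hi⟩
    obtain ⟨F, hFE, hF, hFi⟩ := (LeS.trans (Or.inl hi) (hle n)).copy hE.co
    have hFP : IsPISet F := (hC (n + 1)).of_iso hFi.symm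
    rcases hFP.alt (hF.inter (hU n)) inter_subset_left with h | h
    · exact ⟨⟨F ∩ U n, hFP.of_iso h.symm, h.trans hFi⟩, inter_subset_left.trans hFE,
        Or.inl inter_subset_right⟩
    · refine ⟨⟨F \ (F ∩ U n), hFP.of_iso h.symm, h.trans hFi⟩, sdiff_subset.trans hFE, Or.inr ?_⟩
      exact Set.disjoint_left.2 fun z hz hz' => hz.2 ⟨hz.1, hz'⟩
  choose s hs1 hs2 using step
  let E : ∀ n, {E : Set W // IsPISet E ∧ Iso E (C n)} := fun n =>
    Nat.rec ⟨C 0, hC 0, Iso.refl (hC 0).2.1⟩ (fun n E => s n E) n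
  have hE : ∀ n, (E (n + 1)).1 ⊆ (E n).1 := fun n => hs1 n (E n)
  have hE' : ∀ n, (E (n + 1)).1 ⊆ U n ∨ Disjoint (E (n + 1)).1 (U n) := fun n => hs2 n (E n)
  obtain ⟨v, hv⟩ := IsCompact.nonempty_iInter_of_sequence_nonempty_isCompact_isClosed
    (fun n => (E n).1) hE (fun n => (E n).2.2.symm.nonempty (hne n)) (E 0).2.1.1
    (fun n => (E n).2.1.co.closed)
  rw [mem_iInter] at hv
  refine ⟨v, hv 0, fun A hA => ⟨?_, ?_⟩⟩
  · rintro ⟨B, hB, hvB, hi⟩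
    obtain ⟨n, rfl⟩ := hUs B hB
    refine ⟨n + 1, ?_⟩
    rcases hE' n with h | h
    · exact LeS.trans (Or.inl hi) (((hA.of_iso hi).le (E (n + 1)).2.1.co h).trans
        (Or.inl (E (n + 1)).2.2))
    · exact absurd hvB (Set.disjoint_left.1 h (hv (n + 1)))
  · rintro ⟨n, hn⟩
    exact (hn.trans (Or.inl (E n).2.2.symm)).inS hA.co ((E n).2.1.co.inS (hv n))

theorem LeS.refl {A : Set W} (hA : IsPISet A) : LeS A A := Or.inl (Iso.refl hA.2.1)

theorem exists_gen_pt {C : Set W} (hC : IsPISet C) (hne : C.Nonempty) :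
    ∃ v ∈ C, ∀ A, IsPISet A → (InS A v ↔ LeS A C) := by
  obtain ⟨v, h1, h2⟩ := exists_lim_pt (fun _ => C) (fun _ => hC) (fun _ => hne) (fun _ => LeS.refl hC)
  exact ⟨v, h1, fun A hA => (h2 A hA).trans ⟨fun ⟨_, h⟩ => h, fun h => ⟨0, h⟩⟩⟩

/-- clean points -/
def CleanP (y : W) : Prop := ∃ A, IsPISet A ∧ InS A y ∧ ∀ B, IsPISet B → InS B y → LeS B A

theorem nonclean_seq (hP : PrimitiveSpace W) {y : W} (hy : ¬ CleanP y) :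
    ∃ u : ℕ → W, Tendsto u atTop (𝓝 y) ∧ (∀ n, Lx (u n) (u (n + 1)) ∧ ¬ Lx (u (n + 1)) (u n)) ∧
      (∀ n, Lx (u n) y ∧ ¬ Lx y (u n)) ∧ ∀ q, (∀ n, Lx (u n) q) → Lx y q := by
  obtain ⟨V, hV⟩ := (𝓝 y).exists_antitone_basis
  have step : ∀ n (A : {A : Set W // IsPISet A ∧ y ∈ A}), ∃ A' : {A : Set W // IsPISet A ∧ y ∈ A},
      A'.1 ⊆ A.1 ∧ A'.1 ⊆ V n ∧ ¬ LeS A'.1 A.1 := by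
    rintro n ⟨A, hA, hyA⟩
    have : ∃ B, IsPISet B ∧ InS B y ∧ ¬ LeS B A := by
      by_contra hcon
      push Not at hcon
      exact hy ⟨A, hA, hA.co.inS hyA, hcon⟩
    obtain ⟨B, hB, hBy, hBA⟩ := this
    obtain ⟨H, hH, hyH, hHs, hBH⟩ := exists_PI_le hP
      (inter_mem (hA.2.1.mem_nhds hyA) (hV.1.mem_of_mem (i := n) trivial)) hB hBy
    exact ⟨⟨H, hH, hyH⟩, hHs.trans inter_subset_left, hHs.trans inter_subset_right,
      fun h => hBA (hBH.trans h)⟩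
  choose s hs1 hs2 hs3 using step
  obtain ⟨A0, hA0, hyA0, -⟩ := exists_PI hP (univ_mem : univ ∈ 𝓝 y)
  let A : ℕ → {A : Set W // IsPISet A ∧ y ∈ A} := fun n =>
    Nat.rec ⟨A0, hA0, hyA0⟩ (fun n E => s n E) n
  have a1 : ∀ n, (A (n + 1)).1 ⊆ (A n).1 := fun n => hs1 n (A n)
  have a2 : ∀ n, (A (n + 1)).1 ⊆ V n := fun n => hs2 n (A n)
  have a3 : ∀ n, ¬ LeS (A (n + 1)).1 (A n).1 := fun n => hs3 n (A n)
  have a4 : ∀ n, LeS (A n).1 (A (n + 1)).1 := fun n => (A n).2.1.le (A (n + 1)).2.1.co (a1 n)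
  have gen : ∀ n, ∃ v ∈ (A (n + 1)).1, ∀ B, IsPISet B → (InS B v ↔ LeS B (A (n + 1)).1) := fun n =>
    exists_gen_pt (A (n + 1)).2.1 ⟨y, (A (n + 1)).2.2⟩
  choose u hu1 hu2 using gen
  have hIy : ∀ n, InS (A n).1 y := fun n => (A n).2.1.co.inS (A n).2.2
  refine ⟨u, ?_, ?_, ?_, ?_⟩
  · rw [hV.1.tendsto_right_iff]
    intro i _
    filter_upwards [eventually_ge_atTop i] with n hn
    exact hV.2 hn (a2 n (hu1 n))
  · intro n
    refine ⟨fun B hB h => (hu2 _ B hB).2 (((hu2 _ B hB).1 h).trans (a4 (n + 1))), fun h => ?_⟩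
    exact a3 (n + 1) ((hu2 n _ (A (n + 2)).2.1).1 (h _ (A (n + 2)).2.1
      ((hu2 _ _ (A (n + 2)).2.1).2 (LeS.refl (A (n + 2)).2.1))))
  · intro n
    refine ⟨fun B hB h => ((hu2 _ B hB).1 h).inS hB.co (hIy (n + 1)), fun h => ?_⟩
    exact a3 (n + 1) ((hu2 n _ (A (n + 2)).2.1).1 (h _ (A (n + 2)).2.1 (hIy (n + 2))))
  · rintro q hq B hB ⟨C, hC, hyC, hi⟩
    obtain ⟨n, -, hn⟩ := hV.1.mem_iff.1 (hC.2.mem_nhds hyC)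
    have : LeS B (A (n + 1)).1 := LeS.trans (Or.inl hi) ((hB.of_iso hi).le (A (n + 1)).2.1.co
      ((a2 n).trans hn))
    exact hq n B hB ((hu2 n B hB).2 this)

theorem clean_not_sup (hP : PrimitiveSpace W) {x : W} (hx : CleanP x) (u : ℕ → W)
    (hu : ∀ n, Lx (u n) (u (n + 1)) ∧ ¬ Lx (u (n + 1)) (u n)) (hux : ∀ n, Lx (u n) x)
    (hsup : ∀ q, (∀ n, Lx (u n) q) → Lx x q) : False := by
  obtain ⟨A, hA, hAx, hmax⟩ := hx
  have mono : ∀ m n, m ≤ n → Lx (u m) (u n) := by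
    intro m n hmn
    induction hmn with
    | refl => exact fun _ _ h => h
    | step _ ih => exact ih.trans (hu _).1
  let J : Set (Set W) := {B | IsPISet B ∧ ∃ n, InS B (u n)}
  have hJc : J.Countable := countable_CO.mono (fun B hB => hB.1.co)
  have := hJc.toEncodable
  obtain ⟨B0, hB0, hB0u, -⟩ := exists_PI hP (univ_mem : univ ∈ 𝓝 (u 0))
  have : Inhabited J := ⟨⟨B0, hB0, 0, hB0.co.inS hB0u⟩⟩
  have hdir : Directed LeS (fun B : J => B.1) := by
    rintro ⟨B, hB, n, hn⟩ ⟨C, hC, m, hm⟩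
    have h1 := mono n (max n m) (le_max_left _ _) B hB hn
    have h2 := mono m (max n m) (le_max_right _ _) C hC hm
    obtain ⟨B', hB', hb, hi⟩ := h1
    obtain ⟨H, hH, hxH, hHs, hCH⟩ := exists_PI_le hP (hB'.2.mem_nhds hb) hC h2
    exact ⟨⟨H, hH, _, hH.co.inS hxH⟩, LeS.trans (Or.inl hi) ((hB.of_iso hi).le hH.co hHs), hCH⟩
  let f : J → Set W := fun B => B.1
  obtain ⟨v, -, hv⟩ := exists_lim_pt (fun n => f (hdir.sequence f n)) (fun n => (hdir.sequence f n).2.1)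
    (fun n => by
      obtain ⟨k, hk⟩ := (hdir.sequence f n).2.2
      obtain ⟨z, hz, -⟩ := hk.pt
      exact ⟨z, hz⟩) (fun n => hdir.sequence_mono_nat n)
  have hxv := hsup v (fun n B hB hBu => (hv B hB).2
    ⟨_, hdir.rel_sequence (⟨B, hB, n, hBu⟩ : J)⟩)
  obtain ⟨n, hn⟩ := (hv A hA).1 (hxv A hA hAx)
  obtain ⟨m, hm⟩ := (hdir.sequence f n).2.2
  have hAm : InS A (u m) := hn.inS hA.co hm
  have hxm : Lx x (u m) := fun B hB hBx => (hmax B hB hBx).inS hB.co hAm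
  exact (hu m).2 ((hux (m + 1)).trans hxm)

end PrimToOrbit

section Final
variable {W : Type u} [TopologicalSpace W] [SecondCountableTopology W] [LocallyCompactSpace W]
    [T2Space W] [TotallyDisconnectedSpace W]

theorem mk_eq_iff {w x : W} :
    Quotient.mk (homeoSetoid W) w = Quotient.mk (homeoSetoid W) x ↔ Orb w x := Quotient.eq

theorem mk_set (x : W) : {y : W | Quotient.mk (homeoSetoid W) y = Quotient.mk (homeoSetoid W) x} =
    {y | Orb y x} := Set.ext fun _ => mk_eq_iff

/-- orbit relation -/
def oLt (o₁ o₂ : Quotient (homeoSetoid W)) : Prop := ∃ w : W, Quotient.mk (homeoSetoid W) w = o₁ ∧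
            w ∈ limitPts {x : W | Quotient.mk (homeoSetoid W) x = o₂}

theorem oLt_mk {w x : W} : oLt (Quotient.mk (homeoSetoid W) w) (Quotient.mk (homeoSetoid W) x) ↔
    w ∈ limitPts {y | Orb y x} := by
  unfold oLt
  rw [mk_set]
  constructor
  · rintro ⟨w', h1, h2⟩
    exact lim_inv (mk_eq_iff.1 h1) h2
  · exact fun h => ⟨w, rfl, h⟩

theorem orbit_rank (hP : PrimitiveSpace W) : ∃ S : POSystem (Quotient (homeoSetoid W)),
        (∀ o₁ o₂ : Quotient (homeoSetoid W), S.lt o₁ o₂ ↔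
          ∃ w : W, Quotient.mk (homeoSetoid W) w = o₁ ∧
            w ∈ limitPts {x : W | Quotient.mk (homeoSetoid W) x = o₂}) ∧
        IsRankPartition S
          (fun o : Quotient (homeoSetoid W) =>
            {x : W | Quotient.mk (homeoSetoid W) x = o}) := by
  let S : POSystem (Quotient (homeoSetoid W)) :=
    { lt := oLt
      lt_trans := by
        intro a b c
        induction a using Quotient.ind
        induction b using Quotient.ind
        induction c using Quotient.ind
        rw [oLt_mk, oLt_mk, oLt_mk]
        exact lim_trans
      lt_antisymm := by
        intro a b
        induction a using Quotient.ind
        induction b using Quotient.ind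
        rw [oLt_mk, oLt_mk, mk_eq_iff]
        exact fun h1 h2 => orb_of_Lx hP ((lx_iff hP).2 (Or.inl h1)) ((lx_iff hP).2 (Or.inl h2)) }
  have hle : ∀ w x : W, S.le (Quotient.mk (homeoSetoid W) w) (Quotient.mk (homeoSetoid W) x) ↔ Lx w x := by
    intro w x
    rw [lx_iff hP, ← oLt_mk, ← mk_eq_iff]
    rfl
  have hlt : ∀ w x : W, (S.lt (Quotient.mk (homeoSetoid W) w) (Quotient.mk (homeoSetoid W) x) ∧
      Quotient.mk (homeoSetoid W) w ≠ Quotient.mk (homeoSetoid W) x) ↔ Lx w x ∧ ¬ Lx x w := by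
    intro w x
    rw [← hle, ← hle]
    constructor
    · rintro ⟨h1, h2⟩
      exact ⟨Or.inl h1, fun h => h2 (po_le_antisymm (Or.inl h1) h)⟩
    · rintro ⟨h1, h2⟩
      have : Quotient.mk (homeoSetoid W) w ≠ Quotient.mk (homeoSetoid W) x :=
        fun h => h2 (Or.inr h.symm)
      exact ⟨h1.resolve_right this, this⟩
  have hclean : ∀ y : W, Separated S (Quotient.mk (homeoSetoid W) y) → CleanP y := by
    intro y hs
    by_contra hy
    obtain ⟨u, -, h1, h2, h3⟩ := nonclean_seq hP hy
    refine hs ⟨fun n => Quotient.mk (homeoSetoid W) (u n), fun n => (hlt _ _).2 (h1 n), ?_, ?_⟩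
    · rintro _ ⟨n, rfl⟩
      exact (hle _ _).2 (h2 n).1
    · intro q hq
      induction q using Quotient.ind with
      | _ q =>
      exact (hle _ _).2 (h3 q fun n => (hle _ _).1 (hq _ ⟨n, rfl⟩))
  have hnclean : ∀ y : W, ¬ Separated S (Quotient.mk (homeoSetoid W) y) → ¬ CleanP y := by
    intro y hs hy
    apply hs
    rintro ⟨u, h1, h2, h3⟩
    have hu : ∀ n, Quotient.mk (homeoSetoid W) (u n).out = u n := fun n => Quotient.out_eq _
    refine clean_not_sup hP hy (fun n => (u n).out) (fun n => ?_) (fun n => ?_) (fun q hq => ?_)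
    · rw [← hlt, hu, hu]; exact h1 n
    · rw [← hle, hu]; exact h2 _ ⟨n, rfl⟩
    · rw [← hle]
      apply h3
      rintro _ ⟨n, rfl⟩
      rw [← hu, hle]; exact hq n
  refine ⟨S, fun _ _ => Iff.rfl, ⟨?_, ?_, ?_⟩, ?_, ?_, ?_⟩
  · intro p
    exact ⟨p.out, Quotient.out_eq _⟩
  · intro p q hpq
    exact Set.disjoint_left.2 fun x hx hx' => hpq (hx.symm.trans hx')
  · intro p
    induction p using Quotient.ind with
    | _ p =>
    ext x
    have hx : x ∈ ⋃ q : Quotient (homeoSetoid W), {x : W | Quotient.mk (homeoSetoid W) x = q} :=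
      mem_iUnion.2 ⟨_, rfl⟩
    constructor
    · rintro ⟨h, -⟩
      refine mem_biUnion (x := Quotient.mk (homeoSetoid W) x) ?_ rfl
      exact ⟨x, rfl, h⟩
    · intro h
      obtain ⟨q, hq, hxq⟩ := mem_iUnion₂.1 h
      have hxq : Quotient.mk (homeoSetoid W) x = q := hxq
      subst hxq
      refine ⟨?_, hx⟩
      have := oLt_mk.1 hq
      rw [← mk_set] at this; exact this
  · exact eq_univ_of_forall fun x => mem_iUnion.2 ⟨_, rfl⟩
  · intro q hq z u τz τu hz hu hlim hne hle' _
    have hz : Quotient.mk (homeoSetoid W) z = τz := hz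
    have hu : ∀ k, Quotient.mk (homeoSetoid W) (u k) = τu k := hu
    induction q using Quotient.ind with
    | _ y =>
    obtain ⟨A, hA, hAy, hmax⟩ := hclean y hq
    rw [← hz, hle] at hle'
    obtain ⟨B, hB, hzB, hi⟩ := hle' A hA hAy
    filter_upwards [hlim.eventually (hB.2.mem_nhds hzB)] with k hk
    rw [← hu, hle]
    exact fun C hC hCy => (hmax C hC hCy).inS hC.co ⟨B, hB, hk, hi⟩
  · intro x τx hx hs
    have hx : Quotient.mk (homeoSetoid W) x = τx := hx
    subst hx
    obtain ⟨u, h1, -, h2, -⟩ := nonclean_seq hP (hnclean x hs)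
    exact ⟨u, h1, fun k => ⟨_, rfl, (hlt _ _).2 (h2 k)⟩⟩

end Final

/-- an ω-Stone space is primitive iff it admits a rank partition, iff its
orbit diagram (orbits under homeomorphisms, with `[w] < [x]` iff some point of `[w]` is a
limit of distinct points of `[x]`) forms a rank partition. -/
theorem primitive_iff_rank_partition {W : Type u}
    [TopologicalSpace W] [SecondCountableTopology W] [LocallyCompactSpace W]
    [T2Space W] [TotallyDisconnectedSpace W] :
    List.TFAE [
      PrimitiveSpace W,
      ∃ (P : Type u) (S : POSystem P) (X : P → Set W), IsRankPartition S X,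
      ∃ S : POSystem (Quotient (homeoSetoid W)),
        (∀ o₁ o₂ : Quotient (homeoSetoid W), S.lt o₁ o₂ ↔
          ∃ w : W, Quotient.mk (homeoSetoid W) w = o₁ ∧
            w ∈ limitPts {x : W | Quotient.mk (homeoSetoid W) x = o₂}) ∧
        IsRankPartition S
          (fun o : Quotient (homeoSetoid W) =>
            {x : W | Quotient.mk (homeoSetoid W) x = o})] := by
  tfae_have 1 → 3 := orbit_rank
  tfae_have 3 → 2 := fun ⟨S, _, h⟩ => ⟨_, S, _, h⟩
  tfae_have 2 → 1 := by
    rintro ⟨P, S, X, h⟩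
    obtain ⟨τ, hτ⟩ := rankData_of S X h
    exact hτ.primitive
  tfae_finish
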